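/- arXiv:2204.09769 — 3 statements merged into one kernel-verified Lean document; each statement's English description precedes it below -/
import Mathlib

section
/- Let V ⊆ ℝ² be a connected open set and let u : V → ℝ be harmonic on V. Let γ be a Jordan curve contained in V (the image of a continuous injective map of the circle into V) such that every bounded connected component of ℝ² \ γ is contained in V. If u is constant on γ, then u is constant on all of V. Consequently, no level set of a nonconstant harmonic function on V contains such a loop. -/
open Set Filter Topology

/-- The Laplacian `∂²u/∂x² + ∂²u/∂y²` of a function `u : ℝ² → ℝ` at a point `p`. -/
noncomputable def lap2 (u : ℝ × ℝ → ℝ) (p : ℝ × ℝ) : ℝ :=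
  fderiv ℝ (fun q => fderiv ℝ u q (1, 0)) p (1, 0) +
  fderiv ℝ (fun q => fderiv ℝ u q (0, 1)) p (0, 1)

/-- `u` is harmonic on `Ω ⊆ ℝ²`: twice continuously differentiable with vanishing Laplacian. -/
def HarmonicOn2 (u : ℝ × ℝ → ℝ) (Ω : Set (ℝ × ℝ)) : Prop :=
  ContDiffOn ℝ 2 u Ω ∧ ∀ p ∈ Ω, lap2 u p = 0

/-- `Γ ⊆ ℝ²` is a Jordan curve: the image of a continuous injective map of the circle,
realized as a 1-periodic continuous loop injective on a period. -/
def IsJordanCurve (Γ : Set (ℝ × ℝ)) : Prop :=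
  ∃ γ : ℝ → ℝ × ℝ, Continuous γ ∧ (∀ t, γ (t + 1) = γ t) ∧
    InjOn γ (Ico (0 : ℝ) 1) ∧ γ '' Ico (0 : ℝ) 1 = Γ

theorem hasDerivAt_of_exp_eq {E q : ℂ → ℂ} {q' z : ℂ} (hE : ContinuousAt E z)
    (hEq : ∀ᶠ w in 𝓝 z, Complex.exp (E w) = q w) (hq : HasDerivAt q q' z) :
    HasDerivAt E (q' / q z) z := by
  have hqz : q z ≠ 0 := hEq.self_of_nhds ▸ Complex.exp_ne_zero _
  have him : Tendsto (fun w => (E w - E z).im) (𝓝 z) (𝓝 0) := by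
    have h : ContinuousAt (fun w => (E w - E z).im) z :=
      Complex.continuous_im.continuousAt.comp (hE.sub continuousAt_const)
    simpa [ContinuousAt] using h
  have hloc : ∀ᶠ w in 𝓝 z, E w = E z + Complex.log (q w / q z) := by
    filter_upwards [hEq, him.eventually (Ioo_mem_nhds (neg_lt_zero.2 Real.pi_pos) Real.pi_pos)]
      with w hw hwim
    rw [← hw, ← hEq.self_of_nhds, ← Complex.exp_sub, Complex.log_exp hwim.1 hwim.2.le]
    ring
  have hdiv : q z / q z = 1 := div_self hqz
  have hlog := ((hq.div_const (q z)).clog (by simp [hdiv])).const_add (E z)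
  rw [hdiv, div_one] at hlog
  exact hlog.congr_of_eventuallyEq hloc

/-- On the complement of a path `γ`, the function `z ↦ (γ 1 - z) / (γ 0 - z)` has a continuous
logarithm, which agrees with the principal one near infinity. -/
theorem exists_continuousOn_log_of_path (γ : C(unitInterval, ℂ)) :
    ∃ E : ℂ → ℂ, ContinuousOn E (range γ)ᶜ ∧
      (∀ z ∉ range γ, Complex.exp (E z) = (γ 1 - z) / (γ 0 - z)) ∧
      ∃ R : ℝ, ∀ z ∉ range γ, R < ‖z‖ → E z = Complex.log ((γ 1 - z) / (γ 0 - z)) := by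
  have hne (z : ℂ) (hz : z ∉ range γ) (t : unitInterval) : γ t - z ≠ 0 :=
    fun h => hz ⟨t, sub_eq_zero.1 h⟩
  have hne' (z : ↥(range γ)ᶜ) (t : unitInterval) : (γ t - z) / (γ 0 - z) ≠ 0 :=
    div_ne_zero (hne z z.2 t) (hne z z.2 0)
  let H : C(unitInterval × ↥(range γ)ᶜ, {z : ℂ // z ≠ 0}) :=
    ⟨fun x => ⟨(γ x.1 - x.2) / (γ 0 - x.2), hne' x.2 x.1⟩, by
      refine Continuous.subtype_mk (Continuous.div (by fun_prop) (by fun_prop) ?_) _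
      exact fun x => hne x.2 x.2.2 0⟩
  have H_zero (z : ↥(range γ)ᶜ) : H (0, z) =
      (⟨_, Complex.exp_ne_zero ((ContinuousMap.const _ 0 : C(↥(range γ)ᶜ, ℂ)) z)⟩ :
        {z : ℂ // z ≠ 0}) := by
    ext
    simp [H, div_self (hne z z.2 0)]
  let L := Complex.isCoveringMap_exp.liftHomotopy H (ContinuousMap.const _ 0) H_zero
  have hL : ∀ t z, Complex.exp (L (t, z)) = (γ t - z) / (γ 0 - z) := fun t z =>
    congr_arg Subtype.val (congr_fun (Complex.isCoveringMap_exp.liftHomotopy_lifts H _ H_zero) (t, z))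
  have hL_zero (z) : L (0, z) = 0 := Complex.isCoveringMap_exp.liftHomotopy_zero H _ H_zero z
  classical
  let E : ℂ → ℂ := fun z => if h : z ∈ (range γ)ᶜ then L (1, ⟨z, h⟩) else 0
  have hE (z : ℂ) (hz : z ∉ range γ) : E z = L (1, ⟨z, hz⟩) := dif_pos hz
  refine ⟨E, ?_, fun z hz => by rw [hE z hz, hL], ?_⟩
  · rw [continuousOn_iff_continuous_domRestrict]
    have : (range γ)ᶜ.domRestrict E = fun z => L (1, z) := funext fun z => hE z z.2
    rw [this]
    fun_prop
  obtain ⟨M, hM⟩ := (isCompact_range γ.continuous).isBounded.exists_norm_le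
  refine ⟨3 * M, fun z hz hzM => ?_⟩
  have hslit (t : unitInterval) : (γ t - z) / (γ 0 - z) ∈ Complex.slitPlane := by
    have h0 := hne z hz 0
    have : (γ t - z) / (γ 0 - z) = 1 + (γ t - γ 0) / (γ 0 - z) := by field_simp; ring
    rw [this]
    apply Complex.mem_slitPlane_of_norm_lt_one
    rw [norm_div, div_lt_one (norm_pos_iff.2 h0)]
    have h1 := norm_sub_le (γ t) (γ 0)
    have h2 := norm_sub_norm_le z (γ 0)
    rw [norm_sub_rev] at h2
    linarith [hM _ (mem_range_self t), hM _ (mem_range_self 0)]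
  have key : (fun t => L (t, ⟨z, hz⟩)) = fun t => Complex.log ((γ t - z) / (γ 0 - z)) := by
    refine Complex.isCoveringMap_exp.eq_of_comp_eq (by fun_prop) ?_ ?_ 0 ?_
    · exact Continuous.clog (by fun_prop) hslit
    · ext t
      exact (hL t ⟨z, hz⟩).trans (Complex.exp_log (hne' ⟨z, hz⟩ t)).symm
    · simp [hL_zero, div_self (hne z hz 0)]
  rw [hE z hz]
  exact congr_fun key 1

theorem not_exists_continuous_log_div {a b : ℂ} (hab : a ≠ b) {E : ℂ → ℂ}
    (hE : ∀ z, z ≠ a → z ≠ b → ContinuousAt E z)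
    (hexp : ∀ z, z ≠ a → z ≠ b → Complex.exp (E z) = (b - z) / (a - z)) : False := by
  have hd (z : ℂ) (hza : z ≠ a) (hzb : z ≠ b) :
      HasDerivAt E ((z - a)⁻¹ • ((b - a) / (z - b))) z := by
    have h1 : a - z ≠ 0 := sub_ne_zero.2 hza.symm
    have h2 : b - z ≠ 0 := sub_ne_zero.2 hzb.symm
    have h3 : z - a ≠ 0 := sub_ne_zero.2 hza
    have h4 : z - b ≠ 0 := sub_ne_zero.2 hzb
    have hq := ((hasDerivAt_id z).const_sub b).div ((hasDerivAt_id z).const_sub a) h1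
    convert hasDerivAt_of_exp_eq (hE z hza hzb) ?_ hq using 1
    · simp only [smul_eq_mul, id, Pi.div_apply]
      have h5 : (b - z) / (a - z) = (z - b) / (z - a) := by
        rw [← neg_sub z b, ← neg_sub z a, neg_div_neg_eq]
      rw [h5, ← neg_sub z a]
      field_simp
      ring
    · filter_upwards [isOpen_ne.mem_nhds hza, isOpen_ne.mem_nhds hzb] with w hwa hwb
      exact hexp w hwa hwb
  have hpos : 0 < dist b a := dist_pos.2 hab.symm
  set r := dist b a / 2 with hr
  have hb (z : ℂ) (hz : z ∈ Metric.closedBall a r) : z ≠ b := by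
    rintro rfl
    rw [Metric.mem_closedBall] at hz
    linarith
  have hr0 : 0 < r := by positivity
  have hzero : (∮ z in C(a, r), (z - a)⁻¹ • ((b - a) / (z - b))) = 0 :=
    circleIntegral.integral_eq_zero_of_hasDerivWithinAt hr0.le fun z hz =>
      (hd z (Metric.ne_of_mem_sphere hz hr0.ne')
        (hb z (Metric.sphere_subset_closedBall hz))).hasDerivWithinAt
  have hdiff : DifferentiableOn ℂ (fun z => (b - a) / (z - b)) (Metric.closedBall a r) := by
    intro z hz
    have := sub_ne_zero.2 (hb z hz)
    fun_prop (disch := assumption)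
  rw [hdiff.circleIntegral_sub_inv_smul (Metric.mem_ball_self hr0)] at hzero
  have : (b - a) / (a - b) ≠ 0 := div_ne_zero (sub_ne_zero.2 hab.symm) (sub_ne_zero.2 hab)
  simp [Real.pi_ne_zero, this] at hzero

/-- The union of two arcs which meet only at their common, distinct endpoints separates the
plane. -/
theorem exists_isBounded_connectedComponentIn_compl_arcs (γ₁ γ₂ : C(unitInterval, ℂ))
    (h0 : γ₁ 0 = γ₂ 0) (h1 : γ₁ 1 = γ₂ 1) (hne : γ₁ 0 ≠ γ₁ 1)
    (hinter : range γ₁ ∩ range γ₂ ⊆ {γ₁ 0, γ₁ 1}) :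
    ∃ z ∉ range γ₁ ∪ range γ₂,
      Bornology.IsBounded (connectedComponentIn (range γ₁ ∪ range γ₂)ᶜ z) := by
  by_contra! hunb
  obtain ⟨E₁, hc₁, he₁, R₁, hR₁⟩ := exists_continuousOn_log_of_path γ₁
  obtain ⟨E₂, hc₂, he₂, R₂, hR₂⟩ := exists_continuousOn_log_of_path γ₂
  rw [← h0, ← h1] at he₂ hR₂
  have hopen₁ : IsOpen (range γ₁)ᶜ := (isCompact_range γ₁.continuous).isClosed.isOpen_compl
  have hopen₂ : IsOpen (range γ₂)ᶜ := (isCompact_range γ₂.continuous).isClosed.isOpen_compl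
  have heq (z : ℂ) (hz₁ : z ∉ range γ₁) (hz₂ : z ∉ range γ₂) : E₁ z = E₂ z := by
    have hz : z ∉ range γ₁ ∪ range γ₂ := by simp_all
    have hsub := connectedComponentIn_subset (range γ₁ ∪ range γ₂)ᶜ z
    have hsub₁ := hsub.trans (compl_subset_compl.2 subset_union_left)
    have hsub₂ := hsub.trans (compl_subset_compl.2 subset_union_right)
    obtain ⟨w, hw, hwR⟩ : ∃ w ∈ connectedComponentIn (range γ₁ ∪ range γ₂)ᶜ z,
        max R₁ R₂ < ‖w‖ := by
      by_contra! h
      exact hunb z hz (isBounded_iff_forall_norm_le.2 ⟨_, h⟩)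
    refine Complex.isCoveringMap_exp.eqOn_of_comp_eqOn isPreconnected_connectedComponentIn
      (hc₁.mono hsub₁) (hc₂.mono hsub₂) ?_ hw ?_ (mem_connectedComponentIn hz)
    · intro x hx
      simp [he₁ x (hsub₁ hx), he₂ x (hsub₂ hx)]
    · rw [hR₁ w (hsub₁ hw) ((le_max_left _ _).trans_lt hwR),
        hR₂ w (hsub₂ hw) ((le_max_right _ _).trans_lt hwR)]
  classical
  let E : ℂ → ℂ := fun z => if z ∈ range γ₁ then E₂ z else E₁ z
  have hE₁ : EqOn E E₁ (range γ₁)ᶜ := fun z hz => if_neg hz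
  have hE₂ : EqOn E E₂ (range γ₂)ᶜ := fun z hz => by
    by_cases h : z ∈ range γ₁
    · exact if_pos h
    · rw [hE₁ h, heq z h hz]
  have hcase (z : ℂ) (hz0 : z ≠ γ₁ 0) (hz1 : z ≠ γ₁ 1) :
      z ∈ (range γ₁)ᶜ ∨ z ∈ (range γ₂)ᶜ := by
    by_contra! h
    simp only [mem_compl_iff, not_not] at h
    rcases hinter h with h | h
    exacts [hz0 h, hz1 h]
  refine not_exists_continuous_log_div hne (E := E) (fun z hz0 hz1 => ?_) fun z hz0 hz1 => ?_
  · rcases hcase z hz0 hz1 with h | h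
    · exact ((hc₁.congr hE₁).continuousAt (hopen₁.mem_nhds h))
    · exact ((hc₂.congr hE₂).continuousAt (hopen₂.mem_nhds h))
  · rcases hcase z hz0 hz1 with h | h
    · rw [hE₁ h, he₁ z h]
    · rw [hE₂ h, he₂ z h]

theorem IsJordanCurve.isCompact {Γ : Set (ℝ × ℝ)} (hJ : IsJordanCurve Γ) : IsCompact Γ := by
  obtain ⟨γ, hγ, hper, -, rfl⟩ := hJ
  have h : γ '' Ico 0 1 = γ '' Icc 0 1 := by
    refine (image_mono Ico_subset_Icc_self).antisymm ?_
    rintro _ ⟨t, ht, rfl⟩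
    rcases ht.2.eq_or_lt with rfl | h1
    · exact ⟨0, by simp, by simpa using (hper 0).symm⟩
    · exact ⟨t, ⟨ht.1, h1⟩, rfl⟩
  rw [h]
  exact isCompact_Icc.image hγ

/-- A Jordan curve separates the plane: its complement has a bounded component. -/
theorem IsJordanCurve.exists_isBounded_connectedComponentIn {Γ : Set (ℝ × ℝ)}
    (hJ : IsJordanCurve Γ) :
    ∃ z ∉ Γ, Bornology.IsBounded (connectedComponentIn Γᶜ z) := by
  obtain ⟨γ, hγ, hper, hinj, rfl⟩ := hJ
  let e := Complex.equivRealProdCLM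
  have hγ10 : γ 1 = γ 0 := by simpa using hper 0
  let γ₁ : C(unitInterval, ℂ) := ⟨fun t => e.symm (γ (t / 2)), by fun_prop⟩
  let γ₂ : C(unitInterval, ℂ) := ⟨fun t => e.symm (γ (1 - t / 2)), by fun_prop⟩
  have hunion : range γ₁ ∪ range γ₂ = e.symm '' (γ '' Ico 0 1) := by
    apply Subset.antisymm
    · rintro _ (⟨t, rfl⟩ | ⟨t, rfl⟩)
      · exact mem_image_of_mem _ (mem_image_of_mem _
          ⟨by linarith [t.2.1], by linarith [t.2.2]⟩)
      · rcases t.2.1.eq_or_lt with ht | ht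
        · refine mem_image_of_mem _ ⟨0, by simp, ?_⟩
          rw [← ht, zero_div, sub_zero, hγ10]
        · exact mem_image_of_mem _ (mem_image_of_mem _
            ⟨by linarith [t.2.2], by linarith⟩)
    · rintro _ ⟨_, ⟨t, ht, rfl⟩, rfl⟩
      rcases le_total t (1 / 2) with h | h
      · refine Or.inl ⟨⟨2 * t, by linarith [ht.1], by linarith⟩, ?_⟩
        simp [γ₁]
      · refine Or.inr ⟨⟨2 - 2 * t, by linarith [ht.2], by linarith⟩, ?_⟩
        simp only [γ₂, ContinuousMap.coe_mk]
        congr 2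
        ring
  obtain ⟨z, hz, hb⟩ := exists_isBounded_connectedComponentIn_compl_arcs γ₁ γ₂
    (by simp [γ₁, γ₂, hγ10]) (by norm_num [γ₁, γ₂]) (by
      intro h
      have := hinj (by norm_num) (by norm_num) (e.symm.injective h)
      norm_num at this) (by
      rintro _ ⟨⟨t, rfl⟩, s, hs⟩
      have hs' : γ (1 - s / 2) = γ (t / 2) := e.symm.injective hs
      have ht2 : (t : ℝ) / 2 ∈ Ico (0 : ℝ) 1 := ⟨by linarith [t.2.1], by linarith [t.2.2]⟩
      rcases s.2.1.eq_or_lt with h | h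
      · left
        rw [← h, zero_div, sub_zero, hγ10] at hs'
        change e.symm (γ (t / 2)) = e.symm (γ ((0 : unitInterval) / 2))
        rw [← hs']
        simp
      · right
        have := hinj ⟨by linarith [s.2.2], by linarith⟩ ht2 hs'
        have ht : t = 1 := Subtype.ext (by
          change (t : ℝ) = 1
          linarith [s.2.2, t.2.2])
        rw [ht]
        rfl)
  rw [hunion] at hz hb
  refine ⟨e z, fun h => hz ⟨e z, h, by simp⟩, ?_⟩
  have himage := e.toHomeomorph.image_connectedComponentIn (s := (e.symm '' (γ '' Ico 0 1))ᶜ)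
    (x := z) hz
  have hcompl : e.toHomeomorph '' (e.symm '' (γ '' Ico 0 1))ᶜ = (γ '' Ico 0 1)ᶜ := by
    rw [image_compl_eq e.toHomeomorph.bijective]
    simp [image_image]
  rw [hcompl] at himage
  change Bornology.IsBounded (connectedComponentIn (γ '' Ico 0 1)ᶜ (e.toHomeomorph z))
  rw [← himage]
  exact e.lipschitz.isBounded_image hb

theorem HarmonicOn2.harmonicOnNhd {u : ℝ × ℝ → ℝ} {V : Set (ℝ × ℝ)} (hV : IsOpen V)
    (hu : HarmonicOn2 u V) :
    InnerProductSpace.HarmonicOnNhd (u ∘ Complex.equivRealProdCLM)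
      (Complex.equivRealProdCLM ⁻¹' V) := by
  have hC (p) (hp : p ∈ V) : ContDiffAt ℝ 2 u p := hu.1.contDiffAt (hV.mem_nhds hp)
  intro z hz
  refine ⟨(hC _ hz).comp z Complex.equivRealProdCLM.contDiff.contDiffAt, ?_⟩
  filter_upwards [(hV.preimage Complex.equivRealProdCLM.continuous).mem_nhds hz] with w hw
  have hd : DifferentiableAt ℝ (fderiv ℝ u) (Complex.equivRealProdCLM w) :=
    ((hC _ hw).fderiv_right (m := 1) (by norm_num)).differentiableAt (by norm_num)
  have h := hu.2 _ hw
  rw [lap2, fderiv_clm_apply hd (by fun_prop), fderiv_clm_apply hd (by fun_prop)] at h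
  rw [InnerProductSpace.laplacian_eq_iteratedFDeriv_complexPlane]
  have hcomp : fderiv ℝ (u ∘ Complex.equivRealProdCLM) = fun w =>
      (fderiv ℝ u (Complex.equivRealProdCLM w)).comp
        (Complex.equivRealProdCLM : ℂ →L[ℝ] ℝ × ℝ) :=
    funext fun w => Complex.equivRealProdCLM.comp_right_fderiv
  have hderiv (v : ℂ) : iteratedFDeriv ℝ 2 (u ∘ Complex.equivRealProdCLM) w ![v, v] =
      fderiv ℝ (fderiv ℝ u) (Complex.equivRealProdCLM w)
        (Complex.equivRealProdCLM v) (Complex.equivRealProdCLM v) := by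
    have hd' : HasFDerivAt (fun w => fderiv ℝ u (Complex.equivRealProdCLM w)) _ w :=
      hd.hasFDerivAt.comp w Complex.equivRealProdCLM.hasFDerivAt
    rw [iteratedFDeriv_two_apply, hcomp, (hd'.clm_comp (hasFDerivAt_const _ w)).fderiv]
    simp
  simpa [hderiv] using h

theorem InnerProductSpace.HarmonicAt.eventually_eq_of_isLocalMax {f : ℂ → ℝ} {z : ℂ}
    (hf : InnerProductSpace.HarmonicAt f z) (hmax : IsLocalMax f z) :
    ∀ᶠ w in 𝓝 z, f w = f z := by
  obtain ⟨r, hr, hball⟩ := Metric.eventually_nhds_iff_ball.1 hf.eventually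
  obtain ⟨F, hF, hre⟩ := InnerProductSpace.HarmonicOnNhd.exists_analyticOnNhd_ball_re_eq hball
  have hmem : Metric.ball z r ∈ 𝓝 z := Metric.ball_mem_nhds z hr
  have hnorm (w) (hw : w ∈ Metric.ball z r) : ‖Complex.exp (F w)‖ = Real.exp (f w) := by
    rw [Complex.norm_exp]
    exact congr_arg _ (hre hw)
  have hz := Metric.mem_ball_self (x := z) hr
  have h := Complex.norm_eventually_eq_of_isLocalMax (f := fun w => Complex.exp (F w)) (c := z)
    (by filter_upwards [hmem] with w hw using (hF w hw).differentiableAt.cexp)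
    (by
      filter_upwards [hmem, hmax] with w hw hle
      simpa [hnorm w hw, hnorm z hz] using hle)
  filter_upwards [h, hmem] with w hw hwb
  rw [hnorm w hwb, hnorm z hz] at hw
  exact Real.exp_injective hw

theorem InnerProductSpace.HarmonicAt.eventually_eq_of_isLocalMin {f : ℂ → ℝ} {z : ℂ}
    (hf : InnerProductSpace.HarmonicAt f z) (hmin : IsLocalMin f z) :
    ∀ᶠ w in 𝓝 z, f w = f z := by
  filter_upwards [hf.neg.eventually_eq_of_isLocalMax hmin.neg] with w hw using neg_injective hw

/-- A harmonic function that is constant on the frontier of a nonempty bounded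
open set `B` is constant near some point of `B`. -/
theorem InnerProductSpace.HarmonicOnNhd.exists_eventually_eq {f : ℂ → ℝ} {B : Set ℂ} {c : ℝ}
    (hB : IsOpen B) (hne : B.Nonempty) (hbdd : Bornology.IsBounded B)
    (hf : InnerProductSpace.HarmonicOnNhd f (closure B)) (hc : ∀ z ∈ frontier B, f z = c) :
    ∃ z ∈ B, ∀ᶠ w in 𝓝 z, f w = f z := by
  have hcont : ContinuousOn f (closure B) := fun z hz => (hf z hz).1.continuousAt.continuousWithinAt
  obtain ⟨x, hx, hxmax⟩ := hbdd.isCompact_closure.exists_isMaxOn hne.closure hcont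
  obtain ⟨y, hy, hymin⟩ := hbdd.isCompact_closure.exists_isMinOn hne.closure hcont
  have hnhds (z) (hz : z ∈ B) : closure B ∈ 𝓝 z := mem_of_superset (hB.mem_nhds hz) subset_closure
  by_cases hxB : x ∈ B
  · exact ⟨x, hxB, (hf x hx).eventually_eq_of_isLocalMax (hxmax.isLocalMax (hnhds x hxB))⟩
  by_cases hyB : y ∈ B
  · exact ⟨y, hyB, (hf y hy).eventually_eq_of_isLocalMin (hymin.isLocalMin (hnhds y hyB))⟩
  rw [hB.frontier_eq] at hc
  have hBc (z) (hz : z ∈ B) : f z = c :=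
    le_antisymm (hc x ⟨hx, hxB⟩ ▸ hxmax (subset_closure hz))
      (hc y ⟨hy, hyB⟩ ▸ hymin (subset_closure hz))
  obtain ⟨z, hz⟩ := hne
  exact ⟨z, hz, by filter_upwards [hB.mem_nhds hz] with w hw using by rw [hBc w hw, hBc z hz]⟩

theorem IsClosed.frontier_connectedComponentIn_compl_subset {X : Type*} [TopologicalSpace X]
    [LocallyConnectedSpace X] {K : Set X} (hK : IsClosed K) (z : X) :
    frontier (connectedComponentIn Kᶜ z) ⊆ K := by
  intro x hx
  by_contra hxK
  rw [hK.isOpen_compl.connectedComponentIn.frontier_eq] at hx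
  have hopen : IsOpen (connectedComponentIn Kᶜ x) := hK.isOpen_compl.connectedComponentIn
  obtain ⟨y, hyx, hyz⟩ := mem_closure_iff.1 hx.1 _ hopen (mem_connectedComponentIn hxK)
  rw [connectedComponentIn_eq hyz, ← connectedComponentIn_eq hyx] at hx
  exact hx.2 (mem_connectedComponentIn hxK)

/-- Let `u` be harmonic on a connected open set `V ⊆ ℝ²` and let `Γ ⊆ V` be
a Jordan curve all of whose bounded complementary components lie in `V`. If `u` is constant
on `Γ`, then `u` is constant on all of `V`. -/
theorem level_loop_implies_constant (V : Set (ℝ × ℝ)) (hV : IsOpen V) (hconn : IsConnected V)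
    (u : ℝ × ℝ → ℝ) (hu : HarmonicOn2 u V)
    (Γ : Set (ℝ × ℝ)) (hJ : IsJordanCurve Γ) (hΓV : Γ ⊆ V)
    (hcomp : ∀ z ∉ Γ, Bornology.IsBounded (connectedComponentIn Γᶜ z) →
      connectedComponentIn Γᶜ z ⊆ V)
    (hconst : ∃ c : ℝ, ∀ p ∈ Γ, u p = c) :
    ∃ c : ℝ, ∀ p ∈ V, u p = c := by
  obtain ⟨c, hc⟩ := hconst
  obtain ⟨z, hz, hb⟩ := hJ.exists_isBounded_connectedComponentIn
  have hclosed : IsClosed Γ := hJ.isCompact.isClosed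
  set B := connectedComponentIn Γᶜ z
  have hBV : B ⊆ V := hcomp z hz hb
  have hBopen : IsOpen B := hclosed.isOpen_compl.connectedComponentIn
  have hfr : frontier B ⊆ Γ := hclosed.frontier_connectedComponentIn_compl_subset z
  have hclB : closure B ⊆ V := by
    rw [closure_eq_self_union_frontier]
    exact union_subset hBV (hfr.trans hΓV)
  let e := Complex.equivRealProdCLM
  have hf : InnerProductSpace.HarmonicOnNhd (u ∘ e) (e ⁻¹' V) := hu.harmonicOnNhd hV
  have hcl : closure (e ⁻¹' B) = e ⁻¹' closure B := (e.toHomeomorph.preimage_closure B).symm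
  have hfrB : frontier (e ⁻¹' B) = e ⁻¹' frontier B := (e.toHomeomorph.preimage_frontier B).symm
  obtain ⟨w, hw, hev⟩ := InnerProductSpace.HarmonicOnNhd.exists_eventually_eq
    (f := u ∘ e) (B := e ⁻¹' B) (c := c) (hBopen.preimage e.continuous)
    ⟨e.symm z, by simpa using mem_connectedComponentIn hz⟩
    (e.antilipschitz.isBounded_preimage hb)
    (fun x hx => hf x (hclB (hcl ▸ hx : x ∈ e ⁻¹' closure B)))
    (fun x hx => hc _ (hfr (hfrB ▸ hx : x ∈ e ⁻¹' frontier B)))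
  have hpre : IsPreconnected (e ⁻¹' V) :=
    e.toHomeomorph.isPreconnected_preimage.2 hconn.isPreconnected
  have hconst := AnalyticOnNhd.eqOn_of_preconnected_of_eventuallyEq
    (f := u ∘ e) (g := fun _ => (u ∘ e) w) (fun x hx => HarmonicAt.analyticAt (hf x hx))
    (fun _ _ => analyticAt_const) hpre (hBV hw) hev
  refine ⟨u (e w), fun p hp => ?_⟩
  simpa using hconst (show e.symm p ∈ e ⁻¹' V by simpa using hp)
end

section
/- Let Ω ⊆ ℝ² be a bounded simply connected open set and let u : cl(Ω) → ℝ be continuous on the closure of Ω, harmonic and nonconstant on Ω. Define Max_u := { x ∈ ∂Ω : u(x) ≥ u(y) for all y in some neighborhood of x in cl(Ω) } and Min_u := { x ∈ ∂Ω : u(x) ≤ u(y) for all y in some neighborhood of x in cl(Ω) }. If Max_u and Min_u are each nonempty and connected (each has exactly one connected component), then the critical set C(u) = { x ∈ Ω : ∇u(x) = 0 } is empty. -/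
open Set Filter Topology

theorem countable_image_localMax {α : Type*} [TopologicalSpace α] [SecondCountableTopology α]
    (C : Set α) (u : α → ℝ) :
    (u '' {x ∈ C | ∀ᶠ y in 𝓝[C] x, u y ≤ u x}).Countable := by
  refine ((TopologicalSpace.countable_countableBasis α).image
    (fun B => sSup (u '' (B ∩ C)))).mono ?_
  rintro _ ⟨x, ⟨hxC, hx⟩, rfl⟩
  obtain ⟨B, hB, hxB, hBu⟩ := (TopologicalSpace.isBasis_countableBasis α).mem_nhds_iff.1
    (mem_nhdsWithin_iff_eventually.1 hx)
  refine ⟨B, hB, IsGreatest.csSup_eq ⟨⟨x, ⟨hxB, hxC⟩, rfl⟩, ?_⟩⟩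
  rintro _ ⟨y, ⟨hyB, hyC⟩, rfl⟩
  exact hBu hyB hyC

theorem exists_preconnected_superlevel {α : Type*} [TopologicalSpace α] [T2Space α]
    [SecondCountableTopology α] {C : Set α} (hC : IsCompact C) {u : α → ℝ}
    (hu : ContinuousOn u C) (hmax : IsPreconnected {x ∈ C | ∀ᶠ y in 𝓝[C] x, u y ≤ u x})
    {c : ℝ} {a b : α} (ha : a ∈ C) (hb : b ∈ C) (hca : c < u a) (hcb : c < u b) :
    ∃ K ⊆ {x ∈ C | c ≤ u x}, IsClosed K ∧ IsPreconnected K ∧ a ∈ K ∧ b ∈ K := by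
  set F : Set α := {x ∈ C | c ≤ u x} with hF
  set LM : Set α := {x ∈ C | ∀ᶠ y in 𝓝[C] x, u y ≤ u x} with hLM
  have hFcl : IsClosed F := by
    have := hu.preimage_isClosed_of_isClosed hC.isClosed (isClosed_Ici (a := c))
    exact this
  have hFc : IsCompact F := hC.of_isClosed_subset hFcl fun x hx => hx.1
  have : CompactSpace F := isCompact_iff_compactSpace.1 hFc
  have huF : Continuous (fun x : F => u x) :=
    continuousOn_iff_continuous_domRestrict.1 (hu.mono fun x hx => hx.1)
  have hsub : (u '' LM).Subsingleton :=
    (countable_image_localMax C u).isTotallyDisconnected _ subset_rfl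
      (hmax.image u (hu.mono fun x hx => hx.1))
  -- every relatively clopen piece reaching above level `c` contains a local maximum above `c`
  have key : ∀ N : Set F, IsClopen N → ∀ x ∈ N, c < u x → ∃ y ∈ N, c < u y ∧ (y : α) ∈ LM := by
    intro N hN x hx hcx
    obtain ⟨y, hyN, hy⟩ := hN.isClosed.isCompact.exists_isMaxOn ⟨x, hx⟩ huF.continuousOn
    have hcy : c < u y := hcx.trans_le (hy hx)
    refine ⟨y, hyN, hcy, y.2.1, ?_⟩
    have h1 : ∀ᶠ z in 𝓝[F] (y : α), u z ≤ u y := by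
      rw [nhdsWithin_eq_map_subtype_coe y.2, eventually_map]
      filter_upwards [hN.isOpen.mem_nhds hyN] with z hz using hy hz
    have h2 : ∀ᶠ z in 𝓝[C] (y : α), z ∈ F := by
      filter_upwards [(hu y y.2.1).eventually (lt_mem_nhds hcy), self_mem_nhdsWithin] with z hz hzC
      exact ⟨hzC, hz.le⟩
    rw [eventually_nhdsWithin_iff] at h1
    filter_upwards [h2, nhdsWithin_le_nhds h1] with z hz hz' using hz' hz
  let a' : F := ⟨a, ha, hca.le⟩
  let b' : F := ⟨b, hb, hcb.le⟩
  have hb' : b' ∈ connectedComponent a' := by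
    rw [connectedComponent_eq_iInter_isClopen, mem_iInter]
    rintro ⟨N, hN, haN⟩
    by_contra hbN
    obtain ⟨y, hyN, hcy, hyM⟩ := key N hN a' haN hca
    obtain ⟨z, hzN, -, hzM⟩ := key Nᶜ hN.compl b' hbN hcb
    have hLF : LM ⊆ F := fun w hw =>
      ⟨hw.1, hcy.le.trans (hsub (mem_image_of_mem u hyM) (mem_image_of_mem u hw)).le⟩
    have hpre : IsPreconnected ((↑) ⁻¹' LM : Set F) := by
      rw [← Topology.IsInducing.subtypeVal.isPreconnected_image, Subtype.image_preimage_coe,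
        inter_eq_right.2 hLF]
      exact hmax
    exact hzN (hpre.subset_isClopen hN ⟨y, hyM, hyN⟩ hzM)
  refine ⟨(↑) '' connectedComponent a', ?_, ?_, ?_, ⟨a', mem_connectedComponent, rfl⟩,
    ⟨b', hb', rfl⟩⟩
  · rintro _ ⟨x, -, rfl⟩
    exact x.2
  · exact hFcl.isClosedEmbedding_subtypeVal.isClosedMap _ isClosed_connectedComponent
  · exact isPreconnected_connectedComponent.image _ continuous_subtype_val.continuousOn

namespace Complex

theorem sub_eq_sub_of_exp_eq_mul_exp {K : Set ℂ} (hK : IsPreconnected K) {L M : ℂ → ℂ}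
    (hL : ContinuousOn L K) (hM : ContinuousOn M K) {c : ℂ}
    (h : ∀ z ∈ K, exp (L z) = c * exp (M z)) {a b : ℂ} (ha : a ∈ K) (hb : b ∈ K) :
    L a - M a = L b - M b := by
  have hc : ((fun z => L z - M z) '' K).Countable := by
    refine (countable_range fun n : ℤ => L a - M a + n * (2 * Real.pi * I)).mono ?_
    rintro _ ⟨z, hz, rfl⟩
    have : exp (L z - M z) = exp (L a - M a) := by
      rw [exp_sub, exp_sub, h z hz, h a ha, mul_div_cancel_right₀ _ (exp_ne_zero _),
        mul_div_cancel_right₀ _ (exp_ne_zero _)]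
    obtain ⟨n, hn⟩ := exp_eq_exp_iff_exists_int.1 this
    exact ⟨n, hn.symm⟩
  exact hc.isTotallyDisconnected _ subset_rfl (hK.image _ (hL.sub hM))
    (mem_image_of_mem _ ha) (mem_image_of_mem _ hb)

theorem exists_log_ratio {X S : Set ℂ} (hX : IsClosed X) (hS : IsPreconnected S)
    (hXS : Disjoint X S) {a b : ℂ} (ha : a ∈ S) (hb : b ∈ S) :
    ∃ L : ℂ → ℂ, ContinuousOn L X ∧ ∀ z ∈ X, exp (L z) = (z - a) / (z - b) := by
  have hne : ∀ x ∈ S, ∀ z ∈ X, z - x ≠ 0 := fun x hx z hz h =>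
    hXS.ne_of_mem hz hx (sub_eq_zero.1 h)
  have near : ∀ x ∈ S, ∀ y ∈ S, (∀ z ∈ X, ‖y - x‖ < ‖z - y‖) →
      ∃ L : ℂ → ℂ, ContinuousOn L X ∧ ∀ z ∈ X, exp (L z) = (z - x) / (z - y) := by
    intro x hx y hy hxy
    have hmem : ∀ z ∈ X, (z - x) / (z - y) ∈ slitPlane := by
      intro z hz
      have : (z - x) / (z - y) = 1 + (y - x) / (z - y) := by
        field_simp [hne y hy z hz]
        ring
      rw [this]
      apply mem_slitPlane_of_norm_lt_one
      rw [norm_div, div_lt_one ((norm_nonneg _).trans_lt (hxy z hz))]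
      exact hxy z hz
    refine ⟨fun z => log ((z - x) / (z - y)), ?_, fun z hz => exp_log (slitPlane_ne_zero (hmem z hz))⟩
    exact (ContinuousOn.div (by fun_prop) (by fun_prop) (hne y hy)).clog hmem
  refine hS.induction₂' (fun a b => ∃ L : ℂ → ℂ, ContinuousOn L X ∧
    ∀ z ∈ X, exp (L z) = (z - a) / (z - b)) ?_ ?_ ha hb
  · intro x hx
    obtain ⟨δ, hδ, hball⟩ := Metric.isOpen_iff.1 hX.isOpen_compl x (hXS.notMem_of_mem_right hx)
    have hb' : ∀ᶠ y in 𝓝[S] x, ‖y - x‖ < δ / 2 := by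
      have := nhdsWithin_le_nhds (s := S) (Metric.ball_mem_nhds x (half_pos hδ))
      filter_upwards [this] with y hy
      rwa [mem_ball_iff_norm] at hy
    filter_upwards [hb', self_mem_nhdsWithin] with y hyδ hy
    have hz : ∀ z ∈ X, δ ≤ ‖z - x‖ := fun z hz => by
      by_contra! h
      exact hball (mem_ball_iff_norm.2 h) hz
    refine ⟨near x hx y hy fun z hzX => ?_, near y hy x hx fun z hzX => ?_⟩
    · have := norm_sub_le_norm_sub_add_norm_sub z y x
      linarith [hz z hzX]
    · rw [norm_sub_rev]
      linarith [hz z hzX]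
  · rintro x y w hx hy hw ⟨L, hL, hL'⟩ ⟨M, hM, hM'⟩
    refine ⟨fun z => L z + M z, hL.add hM, fun z hz => ?_⟩
    rw [exp_add, hL' z hz, hM' z hz, div_mul_div_cancel₀ (hne y hy z hz)]

end Complex

namespace Complex

theorem one_sub_ofReal_mul_mem_slitPlane {w : ℂ} (hw : -w ∈ slitPlane) {t : ℝ} (ht : 0 ≤ t) :
    1 - t * w ∈ slitPlane := by
  rcases ht.eq_or_lt with rfl | ht
  · simp
  rw [mem_slitPlane_iff] at hw ⊢
  simp only [neg_re, neg_im, sub_re, one_re, sub_im, one_im, re_ofReal_mul, im_ofReal_mul,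
    zero_sub, ne_eq, neg_eq_zero, mul_eq_zero, ht.ne', false_or] at hw ⊢
  refine hw.imp (fun h => ?_) id
  nlinarith

theorem tendsto_arg_one_sub_ofReal_mul {w : ℂ} (hw : -w ∈ slitPlane) :
    Tendsto (fun t : ℝ => arg (1 - t * w)) atTop (𝓝 (arg (-w))) := by
  have h1 : Tendsto (fun t : ℝ => ((t⁻¹ : ℝ) : ℂ) - w) atTop (𝓝 (-w)) := by
    have : Tendsto (fun t : ℝ => ((t⁻¹ : ℝ) : ℂ)) atTop (𝓝 ((0 : ℝ) : ℂ)) :=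
      (continuous_ofReal.tendsto _).comp tendsto_inv_atTop_zero
    simpa using this.sub_const w
  refine ((continuousAt_arg hw).tendsto.comp h1).congr' ?_
  filter_upwards [eventually_gt_atTop 0] with t ht
  have : (1 : ℂ) - t * w = (t : ℝ) * (((t⁻¹ : ℝ) : ℂ) - w) := by
    have : (t : ℂ) ≠ 0 := ofReal_ne_zero.2 ht.ne'
    push_cast
    field_simp
  rw [this, arg_real_mul _ ht]
  rfl

theorem arg_exp_ofReal_mul_I {θ : ℝ} (h1 : -Real.pi < θ) (h2 : θ ≤ Real.pi) :
    arg (exp (θ * I)) = θ := by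
  rw [← log_im, log_exp (by simpa using h1) (by simpa using h2)]
  simp

theorem isPreconnected_image_ofReal_mul (w : ℂ) (a b : ℝ) :
    IsPreconnected ((fun t : ℝ => (t : ℂ) * w) '' Icc a b) :=
  isPreconnected_Icc.image _ (by fun_prop)

/-- Crossing principle in the plane: let `s = exp (iθ)` with `0 < θ ≤ π / 2`. Disjoint connected
sets `K ∋ 1, s²` and `T ∋ s, s⁻¹`, with `K` closed, cannot exist if `K` avoids the radii ending at
`s` and `s⁻¹` while `T` avoids the radii ending at `1` and `s²`. -/
theorem false_of_crossing {θ : ℝ} (hθ0 : 0 < θ) (hθ : θ ≤ Real.pi / 2) {s : ℂ}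
    (hs : s = exp (θ * I)) {K T : Set ℂ} (hKc : IsClosed K) (hK : IsPreconnected K)
    (hT : IsPreconnected T) (hKT : Disjoint K T) (h1K : 1 ∈ K) (h2K : s ^ 2 ∈ K) (h1T : s ∈ T)
    (h2T : s⁻¹ ∈ T) (h0K : 0 ∉ K)
    (hKs : ∀ t : ℝ, 0 < t → t ≤ 1 → (t : ℂ) * s ∉ K ∧ (t : ℂ) * s⁻¹ ∉ K)
    (hTs : ∀ t : ℝ, 0 ≤ t → t ≤ 1 → (t : ℂ) ∉ T ∧ (t : ℂ) * s ^ 2 ∉ T) : False := by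
  have hpi := Real.pi_pos
  have hs0 : s ≠ 0 := hs ▸ exp_ne_zero _
  have hsn : ‖s‖ = 1 := by rw [hs, norm_exp_ofReal_mul_I]
  have e1 : -s = exp ((θ - Real.pi : ℝ) * I) := by
    push_cast
    rw [sub_mul, exp_sub, exp_pi_mul_I, hs, div_neg, div_one]
  have e2 : -s⁻¹ = exp ((Real.pi - θ : ℝ) * I) := by
    push_cast
    rw [sub_mul, exp_sub, exp_pi_mul_I, hs, neg_div, one_div]
  have e3 : -s ^ 3 = exp ((3 * θ - Real.pi : ℝ) * I) := by
    push_cast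
    rw [sub_mul, exp_sub, exp_pi_mul_I, hs, div_neg, div_one, ← exp_nat_mul]
    push_cast
    ring_nf
  have a1 : arg (-s) = θ - Real.pi := by
    rw [e1]; exact arg_exp_ofReal_mul_I (by linarith) (by linarith)
  have a2 : arg (-s⁻¹) = Real.pi - θ := by
    rw [e2]; exact arg_exp_ofReal_mul_I (by linarith) (by linarith)
  have a3 : arg (-s ^ 3) = 3 * θ - Real.pi := by
    rw [e3]; exact arg_exp_ofReal_mul_I (by linarith) (by linarith)
  have m1 : -s ∈ slitPlane :=
    mem_slitPlane_iff_arg.2 ⟨by rw [a1]; linarith, neg_ne_zero.2 hs0⟩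
  have m2 : -s⁻¹ ∈ slitPlane :=
    mem_slitPlane_iff_arg.2 ⟨by rw [a2]; linarith, neg_ne_zero.2 (inv_ne_zero hs0)⟩
  have m3 : -s ^ 3 ∈ slitPlane :=
    mem_slitPlane_iff_arg.2 ⟨by rw [a3]; linarith, neg_ne_zero.2 (pow_ne_zero _ hs0)⟩
  set R : Set ℂ := (fun t : ℝ => (t : ℂ) * 1) '' Icc 0 1 ∪ (fun t : ℝ => (t : ℂ) * s ^ 2) '' Icc 0 1
    with hR
  have hRc : IsClosed R := by
    apply IsCompact.isClosed
    exact (isCompact_Icc.image (by fun_prop)).union (isCompact_Icc.image (by fun_prop))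
  have hRp : IsPreconnected R :=
    (isPreconnected_image_ofReal_mul 1 0 1).union 0 ⟨0, by simp⟩ ⟨0, by simp⟩
      (isPreconnected_image_ofReal_mul (s ^ 2) 0 1)
  have h1R : (1 : ℂ) ∈ R := Or.inl ⟨1, by simp⟩
  have h2R : s ^ 2 ∈ R := Or.inr ⟨1, by simp⟩
  -- slit plane membership along the two rays in `R`
  have hR1 : ∀ z ∈ R, ∀ t : ℝ, 0 ≤ t → 1 - z * (t * s⁻¹) ∈ slitPlane ∧
      1 - z * (t * s) ∈ slitPlane := by
    rintro z (⟨r, hr, rfl⟩ | ⟨r, hr, rfl⟩) t ht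
    · have hrt : 0 ≤ r * t := mul_nonneg hr.1 ht
      have h1 := one_sub_ofReal_mul_mem_slitPlane m2 hrt
      have h2 := one_sub_ofReal_mul_mem_slitPlane m1 hrt
      push_cast at h1 h2
      refine ⟨?_, ?_⟩
      · convert h1 using 2; ring
      · convert h2 using 2; ring
    · have hrt : 0 ≤ r * t := mul_nonneg hr.1 ht
      have h1 := one_sub_ofReal_mul_mem_slitPlane m1 hrt
      have h2 := one_sub_ofReal_mul_mem_slitPlane m3 hrt
      push_cast at h1 h2
      refine ⟨?_, ?_⟩
      · convert h1 using 2; field_simp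
      · convert h2 using 2; ring
  let N : ℝ → ℂ → ℂ := fun t z => log (1 - z * (t * s⁻¹)) - log (1 - z * (t * s))
  let M : ℝ → ℂ → ℂ := fun t z => log ((z - s / t) / (z - s⁻¹ / t))
  obtain ⟨δ, hδ, hball⟩ := Metric.isOpen_iff.1 hKc.isOpen_compl 0 h0K
  have hKδ : ∀ z ∈ K, δ ≤ ‖z‖ := fun z hz => by
    by_contra! h
    exact hball (mem_ball_zero_iff.2 h) hz
  have main : ∀ᶠ t : ℝ in atTop, (N t 1 - N t (s ^ 2)).im = (M t 1 - M t (s ^ 2)).im := by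
    filter_upwards [eventually_gt_atTop (3 / δ), eventually_ge_atTop 1] with t htδ ht1
    have ht0 : 0 < t := by linarith
    have htc : (t : ℂ) ≠ 0 := ofReal_ne_zero.2 ht0.ne'
    have hti : t⁻¹ ≤ 1 := inv_le_one_of_one_le₀ ht1
    set S : Set ℂ := T ∪ (fun r : ℝ => (r : ℂ) * s) '' Icc t⁻¹ 1 ∪
      (fun r : ℝ => (r : ℂ) * s⁻¹) '' Icc t⁻¹ 1 with hS
    have hSp : IsPreconnected S := by
      refine IsPreconnected.union s⁻¹ (Or.inl h2T) ⟨1, ⟨hti, le_rfl⟩, by simp⟩ ?_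
        (isPreconnected_image_ofReal_mul _ _ _)
      exact hT.union s h1T ⟨1, ⟨hti, le_rfl⟩, by simp⟩ (isPreconnected_image_ofReal_mul _ _ _)
    have hRS : ∀ z ∈ R, ∀ r : ℝ, t⁻¹ ≤ r → z ≠ r * s ∧ z ≠ r * s⁻¹ := by
      intro z hz r hr
      have hr0 : 0 < r := (inv_pos.2 ht0).trans_le hr
      have hrc : (r : ℂ) ≠ 0 := ofReal_ne_zero.2 hr0.ne'
      obtain ⟨h1, h2⟩ := hR1 z hz r⁻¹ (inv_pos.2 hr0).le
      refine ⟨?_, ?_⟩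
      · rintro rfl
        apply slitPlane_ne_zero h1
        push_cast
        field_simp
        simp
      · rintro rfl
        apply slitPlane_ne_zero h2
        push_cast
        field_simp
        simp
    have hdisj : Disjoint (K ∪ R) S := by
      rw [Set.disjoint_left]
      rintro z hz ((hzT | ⟨r, hr, rfl⟩) | ⟨r, hr, rfl⟩)
      · rcases hz with hz | ⟨r, hr, rfl⟩ | ⟨r, hr, rfl⟩
        · exact hKT.ne_of_mem hz hzT rfl
        · exact (hTs r hr.1 hr.2).1 (by simpa using hzT)
        · exact (hTs r hr.1 hr.2).2 hzT
      · rcases hz with hz | hz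
        · exact (hKs r ((inv_pos.2 ht0).trans_le hr.1) hr.2).1 hz
        · exact (hRS _ hz r hr.1).1 rfl
      · rcases hz with hz | hz
        · exact (hKs r ((inv_pos.2 ht0).trans_le hr.1) hr.2).2 hz
        · exact (hRS _ hz r hr.1).2 rfl
    have haS : s / t ∈ S := Or.inl (Or.inr ⟨t⁻¹, ⟨le_rfl, hti⟩, by push_cast; field_simp⟩)
    have hbS : s⁻¹ / t ∈ S := Or.inr ⟨t⁻¹, ⟨le_rfl, hti⟩, by push_cast; field_simp⟩
    obtain ⟨L, hLc, hL⟩ := exists_log_ratio (hKc.union hRc) hSp hdisj haS hbS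
    have hbne : ∀ z ∈ K ∪ R, z - s⁻¹ / t ≠ 0 := fun z hz h =>
      hdisj.ne_of_mem hz hbS (sub_eq_zero.1 h)
    have hMmem : ∀ z ∈ K, (z - s / t) / (z - s⁻¹ / t) ∈ slitPlane := by
      intro z hz
      have hne := hbne z (Or.inl hz)
      have : (z - s / t) / (z - s⁻¹ / t) = 1 + (s⁻¹ / t - s / t) / (z - s⁻¹ / t) := by
        rw [eq_comm, ← sub_eq_zero]
        rw [one_add_div hne]
        ring
      rw [this]
      apply mem_slitPlane_of_norm_lt_one
      rw [norm_div, div_lt_one (norm_pos_iff.2 hne)]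
      have h1 : ‖s⁻¹ / (t : ℂ)‖ = t⁻¹ := by
        rw [norm_div, norm_inv, hsn, norm_real, Real.norm_of_nonneg ht0.le]; simp
      have h2 : ‖s / (t : ℂ)‖ = t⁻¹ := by
        rw [norm_div, hsn, norm_real, Real.norm_of_nonneg ht0.le]; simp
      have h3 := norm_sub_le (s⁻¹ / (t : ℂ)) (s / t)
      have h4 := norm_sub_norm_le z (s⁻¹ / (t : ℂ))
      have h5 : 3 * t⁻¹ < δ := by
        rw [div_lt_iff₀ hδ] at htδ
        rw [← div_eq_mul_inv, div_lt_iff₀ ht0]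
        linarith
      linarith [hKδ z hz]
    have hM : L 1 - M t 1 = L (s ^ 2) - M t (s ^ 2) := by
      refine sub_eq_sub_of_exp_eq_mul_exp (c := 1) hK (hLc.mono subset_union_left) ?_ ?_ h1K h2K
      · exact (ContinuousOn.div (by fun_prop) (by fun_prop)
          fun z hz => hbne z (Or.inl hz)).clog hMmem
      · intro z hz
        rw [hL z (Or.inl hz), exp_log (slitPlane_ne_zero (hMmem z hz)), one_mul]
    have hN : L 1 - N t 1 = L (s ^ 2) - N t (s ^ 2) := by
      refine sub_eq_sub_of_exp_eq_mul_exp (c := s ^ 2) hRp (hLc.mono subset_union_right) ?_ ?_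
        h1R h2R
      · exact (ContinuousOn.clog (by fun_prop) fun z hz => (hR1 z hz t ht0.le).1).sub
          (ContinuousOn.clog (by fun_prop) fun z hz => (hR1 z hz t ht0.le).2)
      · intro z hz
        have n1 := slitPlane_ne_zero (hR1 z hz t ht0.le).1
        have n2 := slitPlane_ne_zero (hR1 z hz t ht0.le).2
        have hne := hbne z (Or.inr hz)
        rw [hL z (Or.inr hz), exp_sub, exp_log n1, exp_log n2, mul_div_assoc', div_eq_div_iff hne n2]
        field_simp
        ring
    rw [show N t 1 - N t (s ^ 2) = M t 1 - M t (s ^ 2) by linear_combination hM - hN]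
  have limN : Tendsto (fun t : ℝ => (N t 1 - N t (s ^ 2)).im) atTop (𝓝 (2 * Real.pi)) := by
    have h := ((tendsto_arg_one_sub_ofReal_mul m2).sub (tendsto_arg_one_sub_ofReal_mul m1)).sub
      ((tendsto_arg_one_sub_ofReal_mul m1).sub (tendsto_arg_one_sub_ofReal_mul m3))
    rw [a1, a2, a3] at h
    convert h using 2
    · rename_i t
      have q1 : s ^ 2 * ((t : ℂ) * s⁻¹) = t * s := by field_simp
      have q2 : s ^ 2 * ((t : ℂ) * s) = t * s ^ 3 := by ring
      simp only [N, sub_im, log_im, one_mul, q1, q2]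
    · ring
  have limM : Tendsto (fun t : ℝ => (M t 1 - M t (s ^ 2)).im) atTop (𝓝 0) := by
    have hinv : ∀ w : ℂ, Tendsto (fun t : ℝ => w / (t : ℂ)) atTop (𝓝 0) := by
      intro w
      have : Tendsto (fun t : ℝ => ((t⁻¹ : ℝ) : ℂ)) atTop (𝓝 ((0 : ℝ) : ℂ)) :=
        (continuous_ofReal.tendsto _).comp tendsto_inv_atTop_zero
      simpa [div_eq_mul_inv] using this.const_mul w
    have h : ∀ z : ℂ, z ≠ 0 → Tendsto (fun t : ℝ => (M t z).im) atTop (𝓝 0) := by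
      intro z hz
      have h1 : Tendsto (fun t : ℝ => (z - s / t) / (z - s⁻¹ / t)) atTop (𝓝 1) := by
        have := ((hinv s).const_sub z).div ((hinv s⁻¹).const_sub z) (by simpa using hz)
        rw [sub_zero, div_self hz] at this
        exact this
      have h2 := (continuousAt_arg one_mem_slitPlane).tendsto.comp h1
      simpa [M, log_im, Function.comp_def] using h2
    simpa using (h 1 one_ne_zero).sub (h (s ^ 2) (pow_ne_zero _ hs0))
  have := tendsto_nhds_unique (limN.congr' main) limM
  linarith

end Complex

open InnerProductSpace in
theorem HarmonicOn2.harmonicOnNhd_comp {u : ℝ × ℝ → ℝ} {Ω : Set (ℝ × ℝ)} (hΩ : IsOpen Ω)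
    (hu : HarmonicOn2 u Ω) :
    HarmonicOnNhd (u ∘ Complex.equivRealProdCLM) (Complex.equivRealProdCLM ⁻¹' Ω) := by
  set e := Complex.equivRealProdCLM with he
  intro z hz
  have hev : ∀ᶠ w in 𝓝 z, e w ∈ Ω :=
    e.continuous.continuousAt.eventually_mem (hΩ.mem_nhds hz)
  have hcd : ∀ w, e w ∈ Ω → ContDiffAt ℝ 2 (u ∘ e) w := fun w hw =>
    (hu.1.contDiffAt (hΩ.mem_nhds hw)).comp w e.contDiff.contDiffAt
  refine ⟨hcd z hz, ?_⟩
  filter_upwards [hev] with w hw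
  have key : ∀ d : ℂ, iteratedFDeriv ℝ 2 (u ∘ e) w ![d, d] =
      fderiv ℝ (fun q => fderiv ℝ u q (e d)) (e w) (e d) := by
    intro d
    have h1 : (fun x => fderiv ℝ (u ∘ e) x d) = (fun q => fderiv ℝ u q (e d)) ∘ e := by
      ext x
      rw [e.comp_right_fderiv]
      rfl
    have h2 : DifferentiableAt ℝ (fderiv ℝ (u ∘ e)) w :=
      ((hcd w hw).fderiv_right (m := 1) (by norm_num)).differentiableAt (by norm_num)
    have h3 : fderiv ℝ (fun x => fderiv ℝ (u ∘ e) x d) w d =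
        fderiv ℝ (fderiv ℝ (u ∘ e)) w d d := by
      rw [fderiv_clm_apply h2 (by fun_prop)]
      simp
    rw [iteratedFDeriv_two_apply]
    simp only [Matrix.cons_val_zero, Matrix.cons_val_one]
    rw [← h3, h1, e.comp_right_fderiv]
    rfl
  rw [laplacian_eq_iteratedFDeriv_complexPlane]
  simp only [key]
  have := hu.2 (e w) hw
  rw [lap2] at this
  simpa [he] using this

open InnerProductSpace in
theorem InnerProductSpace.HarmonicAt.exists_leading_term {v : ℂ → ℝ} {z : ℂ}
    (hv : HarmonicAt v z) (hnc : ¬ ∀ᶠ w in 𝓝 z, v w = v z) :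
    ∃ (n : ℕ) (c : ℂ), n ≠ 0 ∧ c ≠ 0 ∧
      (∀ d : ℂ, 0 < (c * d ^ n).re → ∀ᶠ t : ℝ in 𝓝[>] 0, v z < v (z + t * d)) ∧
      (∀ d : ℂ, (c * d ^ n).re < 0 → ∀ᶠ t : ℝ in 𝓝[>] 0, v (z + t * d) < v z) ∧
      (fderiv ℝ v z = 0 → 2 ≤ n) := by
  obtain ⟨ε, hε, hball⟩ := Metric.isOpen_iff.1 (isOpen_setOfPred_harmonicAt v) z hv
  obtain ⟨F, hF, hFv⟩ := HarmonicOnNhd.exists_analyticOnNhd_ball_re_eq (f := v) (z := z) (R := ε)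
    fun _ hy => hball hy
  have hFz := hF z (Metric.mem_ball_self hε)
  have hvF : ∀ᶠ w in 𝓝 z, (F w).re = v w :=
    eventually_of_mem (Metric.ball_mem_nhds z hε) fun w hw => hFv hw
  have hG : AnalyticAt ℂ (fun w => F w - F z) z := hFz.sub analyticAt_const
  obtain ⟨n, g, hg, hgz, hGg⟩ := hG.exists_eventuallyEq_pow_smul_nonzero_iff.2 fun h => hnc <| by
    filter_upwards [h, hvF] with w hw hw'
    rw [← hw', ← hvF.self_of_nhds, sub_eq_zero.1 hw]
  have hn : n ≠ 0 := by
    rintro rfl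
    have := hGg.self_of_nhds
    simp only [sub_self, pow_zero, one_smul] at this
    exact hgz this.symm
  have hline : ∀ d : ℂ, Tendsto (fun t : ℝ => z + t * d) (𝓝[>] 0) (𝓝 z) := by
    intro d
    have : Continuous fun t : ℝ => z + t * d := by fun_prop
    simpa using (this.tendsto 0).mono_left (nhdsWithin_le_nhds (s := Ioi 0))
  have hlim : ∀ d : ℂ, Tendsto (fun t : ℝ => (g (z + t * d) * d ^ n).re) (𝓝[>] 0)
      (𝓝 (g z * d ^ n).re) := fun d =>
    (Complex.continuous_re.tendsto _).comp
      ((hg.continuousAt.tendsto.comp (hline d)).mul_const (d ^ n))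
  have hdiff : ∀ d : ℂ, ∀ᶠ t : ℝ in 𝓝[>] 0,
      0 < t ^ n ∧ v (z + t * d) - v z = t ^ n * (g (z + t * d) * d ^ n).re := by
    intro d
    filter_upwards [(hline d).eventually hGg, (hline d).eventually hvF, self_mem_nhdsWithin]
      with t h1 h2 ht
    refine ⟨pow_pos ht n, ?_⟩
    rw [← h2, ← hvF.self_of_nhds, ← Complex.sub_re, h1, ← Complex.re_ofReal_mul, smul_eq_mul]
    congr 1
    push_cast
    ring
  refine ⟨n, g z, hn, hgz, fun d hd => ?_, fun d hd => ?_, fun h0 => ?_⟩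
  · filter_upwards [hdiff d, (hlim d).eventually (lt_mem_nhds hd)] with t ⟨h1, h2⟩ h3
    have := mul_pos h1 h3
    linarith
  · filter_upwards [hdiff d, (hlim d).eventually (gt_mem_nhds hd)] with t ⟨h1, h2⟩ h3
    have := mul_neg_of_pos_of_neg h1 h3
    linarith
  · by_contra! hlt
    obtain rfl : n = 1 := by omega
    have hd : HasDerivAt (fun w => F w - F z) (g z) z := by
      have h1 := ((hasDerivAt_id z).sub_const z).mul hg.differentiableAt.hasDerivAt
      have h2 : HasDerivAt (fun w => F w - F z) _ z := h1.congr_of_eventuallyEq (by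
        filter_upwards [hGg] with w hw
        simpa using hw)
      simpa using h2
    have hdF : HasDerivAt F (g z) z := by simpa using hd.add_const (F z)
    have hfv : HasFDerivAt v (Complex.reCLM.comp
        ((ContinuousLinearMap.toSpanSingleton ℂ (g z)).restrictScalars ℝ)) z :=
      (Complex.reCLM.hasFDerivAt.comp z
        (hdF.hasFDerivAt.restrictScalars ℝ)).congr_of_eventuallyEq (by
          filter_upwards [hvF] with w hw using hw.symm)
    have h1 := hfv.fderiv
    rw [h0] at h1
    have h2 := DFunLike.congr_fun h1 (starRingEnd ℂ (g z))
    simp only [_root_.zero_apply, ContinuousLinearMap.comp_apply,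
      ContinuousLinearMap.coe_restrictScalars', ContinuousLinearMap.toSpanSingleton_apply,
      smul_eq_mul, mul_comm, Complex.mul_conj, Complex.reCLM_apply, Complex.ofReal_re] at h2
    exact hgz (Complex.normSq_eq_zero.1 h2.symm)

open InnerProductSpace in
theorem InnerProductSpace.HarmonicOnNhd.eqOn_of_eventually_eq_const {v : ℂ → ℝ} {U : Set ℂ}
    (hv : HarmonicOnNhd v U) (hU : IsPreconnected U) {z : ℂ} (hz : z ∈ U) {c : ℝ}
    (h : ∀ᶠ w in 𝓝 z, v w = c) : ∀ w ∈ U, v w = c :=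
  AnalyticOnNhd.eqOn_of_preconnected_of_eventuallyEq (𝕜 := ℝ) (g := fun _ => c)
    (fun w hw => HarmonicAt.analyticAt (hv w hw)) analyticOnNhd_const hU hz h

/-- On a bounded connected open set, a nonconstant harmonic function whose sets of boundary local
maxima and of boundary local minima are both preconnected has no critical point. -/
theorem fderiv_ne_zero_of_preconnected_extrema {Ω : Set (ℝ × ℝ)} (hΩo : IsOpen Ω)
    (hΩb : Bornology.IsBounded Ω) (hΩc : IsPreconnected Ω) {u : ℝ × ℝ → ℝ}
    (hu : ContinuousOn u (closure Ω)) (huh : HarmonicOn2 u Ω)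
    (hnc : ¬ ∃ c : ℝ, ∀ x ∈ Ω, u x = c)
    (hmax : IsPreconnected {x ∈ frontier Ω | ∀ᶠ y in 𝓝[closure Ω] x, u y ≤ u x})
    (hmin : IsPreconnected {x ∈ frontier Ω | ∀ᶠ y in 𝓝[closure Ω] x, u x ≤ u y})
    {p : ℝ × ℝ} (hp : p ∈ Ω) : fderiv ℝ u p ≠ 0 := by
  intro hcrit
  set e := Complex.equivRealProdCLM with he
  set v : ℂ → ℝ := u ∘ e with hv
  have hvh := huh.harmonicOnNhd_comp hΩo
  rw [← he, ← hv] at hvh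
  have hUc : IsPreconnected (e ⁻¹' Ω) := (e.toHomeomorph.isPreconnected_preimage).2 hΩc
  have hvnc : ∀ z ∈ e ⁻¹' Ω, ¬ ∀ᶠ w in 𝓝 z, v w = v z := fun z hz h => hnc
    ⟨v z, fun x hx => by
      have := hvh.eqOn_of_eventually_eq_const hUc hz h (e.symm x) (by simpa using hx)
      simpa [hv] using this⟩
  have hcl : ∀ z ∈ e ⁻¹' Ω, ∀ d : ℂ,
      Tendsto (fun t : ℝ => e (z + t * d)) (𝓝[>] 0) (𝓝[closure Ω] (e z)) := by
    intro z hz d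
    rw [nhdsWithin_eq_nhds.2 (mem_of_superset (hΩo.mem_nhds hz) subset_closure)]
    have : Continuous fun t : ℝ => e (z + t * d) := by fun_prop
    simpa using (this.tendsto 0).mono_left (nhdsWithin_le_nhds (s := Ioi 0))
  have hfr : ∀ x ∈ closure Ω, x ∉ Ω → x ∈ frontier Ω := fun x hx hx' => by
    rw [hΩo.frontier_eq]
    exact ⟨hx, hx'⟩
  have hmax' : IsPreconnected {x ∈ closure Ω | ∀ᶠ y in 𝓝[closure Ω] x, u y ≤ u x} := by
    convert hmax using 1
    refine Subset.antisymm (fun x hx => ⟨hfr x hx.1 fun hxΩ => ?_, hx.2⟩)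
      fun x hx => ⟨frontier_subset_closure hx.1, hx.2⟩
    have hz : e.symm x ∈ e ⁻¹' Ω := by simpa using hxΩ
    obtain ⟨n, c, hn, hc, hpos, -, -⟩ := (hvh _ hz).exists_leading_term (hvnc _ hz)
    obtain ⟨d, hd⟩ := IsAlgClosed.exists_pow_nat_eq c⁻¹ (Nat.pos_of_ne_zero hn)
    have h1 := hpos d (by simp [hd, hc])
    have h2 := (hcl _ hz d).eventually (by simpa using hx.2)
    obtain ⟨t, ht1, ht2⟩ := (h1.and h2).exists
    simp only [hv, Function.comp_apply, e.apply_symm_apply] at ht1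
    linarith
  have hmin' : IsPreconnected {x ∈ closure Ω | ∀ᶠ y in 𝓝[closure Ω] x, -u y ≤ -u x} := by
    simp only [neg_le_neg_iff]
    convert hmin using 1
    refine Subset.antisymm (fun x hx => ⟨hfr x hx.1 fun hxΩ => ?_, hx.2⟩)
      fun x hx => ⟨frontier_subset_closure hx.1, hx.2⟩
    have hz : e.symm x ∈ e ⁻¹' Ω := by simpa using hxΩ
    obtain ⟨n, c, hn, hc, -, hneg, -⟩ := (hvh _ hz).exists_leading_term (hvnc _ hz)
    obtain ⟨d, hd⟩ := IsAlgClosed.exists_pow_nat_eq (-c⁻¹) (Nat.pos_of_ne_zero hn)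
    have h1 := hneg d (by simp [hd, hc])
    have h2 := (hcl _ hz d).eventually (by simpa using hx.2)
    obtain ⟨t, ht1, ht2⟩ := (h1.and h2).exists
    simp only [hv, Function.comp_apply, e.apply_symm_apply] at ht1
    linarith
  obtain ⟨z, rfl⟩ := e.surjective p
  obtain ⟨n, c, hn, hc, hpos, hneg, hn2⟩ := (hvh z hp).exists_leading_term (hvnc z hp)
  have hn2 : 2 ≤ n := hn2 (by rw [hv, e.comp_right_fderiv, hcrit, ContinuousLinearMap.zero_comp])
  obtain ⟨d₀, hd₀⟩ := IsAlgClosed.exists_pow_nat_eq c⁻¹ (Nat.pos_of_ne_zero hn)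
  have hnR : (2 : ℝ) ≤ n := by exact_mod_cast hn2
  set θ : ℝ := Real.pi / n with hθ
  set s : ℂ := Complex.exp (θ * Complex.I) with hs
  have hs0 : s ≠ 0 := Complex.exp_ne_zero _
  have hsn : s ^ n = -1 := by
    rw [hs, ← Complex.exp_nat_mul, hθ, ← Complex.exp_pi_mul_I]
    congr 1
    push_cast
    field_simp
  have hcd : c * d₀ ^ n = 1 := by rw [hd₀, mul_inv_cancel₀ hc]
  have r1 := hpos (d₀ * 1) (by simp [hcd])
  have r2 := hneg (d₀ * s) (by rw [mul_pow, ← mul_assoc, hcd, hsn]; simp)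
  have r3 := hpos (d₀ * s ^ 2) (by
    rw [mul_pow, ← mul_assoc, hcd, ← pow_mul, mul_comm 2, pow_mul, hsn]; simp)
  have r4 := hneg (d₀ * s⁻¹) (by rw [mul_pow, ← mul_assoc, hcd, inv_pow, hsn]; simp)
  have hmem : ∀ d : ℂ, ∀ᶠ t : ℝ in 𝓝[>] 0, e (z + t * d) ∈ closure Ω := fun d =>
    (hcl z hp d).eventually self_mem_nhdsWithin
  obtain ⟨r, hr0, hr⟩ := mem_nhdsGT_iff_exists_Ioc_subset.1 (((r1.and r2).and (r3.and r4)).and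
    (((hmem (d₀ * 1)).and (hmem (d₀ * s))).and ((hmem (d₀ * s ^ 2)).and (hmem (d₀ * s⁻¹)))))
  have hr0 : 0 < r := hr0
  have hd0 : d₀ ≠ 0 := by
    rintro rfl
    rw [zero_pow hn] at hd₀
    exact inv_ne_zero hc hd₀.symm
  have hrd : (r : ℂ) * d₀ ≠ 0 := mul_ne_zero (Complex.ofReal_ne_zero.2 hr0.ne') hd0
  let φ : ℂ ≃ₜ ℝ × ℝ := ((Homeomorph.mulLeft₀ _ hrd).trans (Homeomorph.addLeft z)).trans
    e.toHomeomorph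
  have hφ : ∀ w, φ w = e (z + r * d₀ * w) := fun w => rfl
  have hφ' : ∀ (t : ℝ) (w : ℂ), φ (t * w) = e (z + (r * t : ℝ) * (d₀ * w)) := fun t w => by
    rw [hφ]
    congr 2
    push_cast
    ring
  have hφ0 : φ 0 = e z := by simp [hφ]
  have hray : ∀ t : ℝ, 0 < t → t ≤ 1 → _ := fun t ht0 ht1 =>
    hr ⟨mul_pos hr0 ht0, by nlinarith⟩
  simp only [mem_ofPred_eq, hv, Function.comp_apply, ← hφ'] at hray
  simp only [mul_one] at hray
  obtain ⟨⟨⟨h1, h2⟩, h3, h4⟩, ⟨k1, k2⟩, k3, k4⟩ := hray 1 one_pos le_rfl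
  simp only [Complex.ofReal_one, one_mul] at h1 h2 h3 h4 k1 k2 k3 k4
  obtain ⟨C, hC0, hC⟩ := exists_between (lt_min h1 h3)
  obtain ⟨D, hD, hD0⟩ := exists_between (max_lt h2 h4)
  obtain ⟨K, hKsub, hKc, hK, h1K, h3K⟩ := exists_preconnected_superlevel
    hΩb.isCompact_closure hu hmax' k1 k3 (hC.trans_le (min_le_left _ _))
    (hC.trans_le (min_le_right _ _))
  obtain ⟨T, hTsub, -, hT, h2T, h4T⟩ := exists_preconnected_superlevel (u := fun x => -u x)
    (c := -D) hΩb.isCompact_closure hu.neg hmin' k2 k4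
    (neg_lt_neg ((le_max_left _ _).trans_lt hD)) (neg_lt_neg ((le_max_right _ _).trans_lt hD))
  have hKu : ∀ w, φ w ∈ K → u (e z) < u (φ w) := fun w hw => hC0.trans_le (hKsub hw).2
  have hTu : ∀ w, φ w ∈ T → u (φ w) < u (e z) := fun w hw =>
    (neg_le_neg_iff.1 (hTsub hw).2).trans_lt hD0
  refine Complex.false_of_crossing (θ := θ) (s := s) (K := φ ⁻¹' K) (T := φ ⁻¹' T) (by positivity)
    ?_ hs (hKc.preimage φ.continuous) (φ.isPreconnected_preimage.2 hK)
    (φ.isPreconnected_preimage.2 hT) ?_ h1K h3K h2T h4T ?_ ?_ ?_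
  · exact div_le_div_of_nonneg_left Real.pi_pos.le two_pos hnR
  · rw [Set.disjoint_left]
    exact fun w hwK hwT => lt_asymm (hKu w hwK) (hTu w hwT)
  · intro h
    have := hKu 0 h
    rw [hφ0] at this
    exact lt_irrefl _ this
  · intro t ht0 ht1
    obtain ⟨⟨⟨-, h2⟩, -, h4⟩, -⟩ := hray t ht0 ht1
    exact ⟨fun h => lt_asymm h2 (hKu _ h), fun h => lt_asymm h4 (hKu _ h)⟩
  · intro t ht0 ht1
    rcases ht0.eq_or_lt with rfl | ht0
    · have : φ 0 ∉ T := fun h => by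
        have := hTu 0 h
        rw [hφ0] at this
        exact lt_irrefl _ this
      simpa using this
    · obtain ⟨⟨⟨h1, -⟩, h3, -⟩, -⟩ := hray t ht0 ht1
      exact ⟨fun h => lt_asymm h1 (hTu _ h), fun h => lt_asymm h3 (hTu _ h)⟩

/-- Let `Ω ⊆ ℝ²` be a bounded simply connected open set and `u` continuous
on `cl(Ω)`, harmonic and nonconstant on `Ω`. If the set of boundary local-maximum points and
the set of boundary local-minimum points (with neighborhoods taken in `cl(Ω)`) are each
nonempty and connected, then `u` has no critical point in `Ω`. -/
theorem one_max_one_min_implies_no_critical_point (Ω : Set (ℝ × ℝ))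
    (hΩo : IsOpen Ω) (hΩb : Bornology.IsBounded Ω) (hΩsc : SimplyConnectedSpace Ω)
    (u : ℝ × ℝ → ℝ) (hu : ContinuousOn u (closure Ω)) (huh : HarmonicOn2 u Ω)
    (hnc : ¬ ∃ c : ℝ, ∀ x ∈ Ω, u x = c)
    (hmax : IsConnected {x ∈ frontier Ω | ∀ᶠ y in 𝓝[closure Ω] x, u y ≤ u x})
    (hmin : IsConnected {x ∈ frontier Ω | ∀ᶠ y in 𝓝[closure Ω] x, u x ≤ u y}) :
    {x ∈ Ω | fderiv ℝ u x = 0} = ∅ := by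

  have hΩc : IsPreconnected Ω := isPreconnected_iff_preconnectedSpace.2 inferInstance
  exact eq_empty_of_forall_notMem fun p hp => fderiv_ne_zero_of_preconnected_extrema hΩo hΩb hΩc
    hu huh hnc hmax.isPreconnected hmin.isPreconnected hp.1 hp.2
end

section
/- Let V ⊆ ℝ² be a simple polygon with vertices v₁,…,vₙ listed in counterclockwise order, let φ₁,…,φₙ be harmonic generalized barycentric coordinates on V, and let W ⊆ ℝ² be a convex polygon with vertices w₁,…,wₙ listed in counterclockwise order. Then the harmonic GBC map F(x) = Σᵢ₌₁ⁿ φᵢ(x)·wᵢ is injective on V. -/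
open Set Filter Topology

/-- The 1-periodic loop `γ` winds once counterclockwise around the point `z`: it admits a
continuous polar-coordinate representation around `z` whose angle increases by `2π`
over one period. -/
def WindsCCWAround (γ : ℝ → ℝ × ℝ) (z : ℝ × ℝ) : Prop :=
  ∃ r θ : ℝ → ℝ, Continuous r ∧ Continuous θ ∧ (∀ t, 0 < r t) ∧
    (∀ t, γ t - z = (r t * Real.cos (θ t), r t * Real.sin (θ t))) ∧
    (∀ t, θ (t + 1) = θ t + 2 * Real.pi)

/-- `γ` is a counterclockwise Jordan parametrization of the boundary of `V`: a 1-periodic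
continuous loop, injective on a period, whose image is `frontier V`, and which winds once
counterclockwise around every interior point of `V`. -/
def IsCCWBoundaryParam (γ : ℝ → ℝ × ℝ) (V : Set (ℝ × ℝ)) : Prop :=
  Continuous γ ∧ (∀ t, γ (t + 1) = γ t) ∧ InjOn γ (Ico (0 : ℝ) 1) ∧
  γ '' Ico (0 : ℝ) 1 = frontier V ∧ ∀ z ∈ interior V, WindsCCWAround γ z

/-- `γ` is a counterclockwise piecewise-linear parametrization of the boundary of `V`
through the vertices `v 0, …, v (n-1)` (the vertex list `v` is read cyclically). -/
def IsPolygonalCCWParam (γ : ℝ → ℝ × ℝ) (n : ℕ) (v : ℕ → ℝ × ℝ) (V : Set (ℝ × ℝ)) : Prop :=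
  IsCCWBoundaryParam γ V ∧
  ∀ i : ℕ, ∀ s ∈ Icc (0 : ℝ) 1, γ ((i + s) / n) = (1 - s) • v i + s • v (i + 1)

/-- `V` is the simple polygon (compact region bounded by a simple closed polygonal curve)
with vertices `v 0, …, v (n-1)` listed in counterclockwise order. -/
def IsSimplePolygonCCW (V : Set (ℝ × ℝ)) (n : ℕ) (v : ℕ → ℝ × ℝ) : Prop :=
  3 ≤ n ∧ (∀ i, v (i + n) = v i) ∧ IsCompact V ∧ V = closure (interior V) ∧
  (interior V).Nonempty ∧ ∃ γ, IsPolygonalCCWParam γ n v V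

/-- `W` is the convex polygon with vertices `w 0, …, w (n-1)`, which lie on its boundary
in counterclockwise order. -/
def IsConvexPolygonCCW (W : Set (ℝ × ℝ)) (n : ℕ) (w : ℕ → ℝ × ℝ) : Prop :=
  (∀ i, w (i + n) = w i) ∧ W = convexHull ℝ (range w) ∧ ∃ γ, IsPolygonalCCWParam γ n w W

/-- `φ 0, …, φ (n-1)` are harmonic generalized barycentric coordinates on the polygon `V`
with vertices `v 0, …, v (n-1)`. -/
def IsHarmonicGBC (n : ℕ) (v : ℕ → ℝ × ℝ) (V : Set (ℝ × ℝ)) (φ : ℕ → (ℝ × ℝ) → ℝ) : Prop :=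
  (∀ i, ContinuousOn (φ i) V) ∧ (∀ i, HarmonicOn2 (φ i) (interior V)) ∧
  (∀ x ∈ V, ∑ i ∈ Finset.range n, φ i x = 1) ∧
  (∀ x ∈ V, ∑ i ∈ Finset.range n, φ i x • v i = x) ∧
  (∀ i, ∀ x ∈ V, 0 ≤ φ i x) ∧
  (∀ i j, ∀ s ∈ Icc (0 : ℝ) 1,
    φ i ((1 - s) • v j + s • v (j + 1)) = (1 - s) * φ i (v j) + s * φ i (v (j + 1))) ∧
  (∀ i j, i < n → j < n → φ i (v j) = if i = j then 1 else 0)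

/-- Two continuous logarithms of the same function on a preconnected set differ by a constant. -/
theorem IsPreconnected.log_sub_log_const {X : Type*} [TopologicalSpace X] {S : Set X}
    (hS : IsPreconnected S) {f g : X → ℂ} (hf : ContinuousOn f S) (hg : ContinuousOn g S)
    (h : ∀ x ∈ S, Complex.exp (f x) = Complex.exp (g x)) {x y : X} (hx : x ∈ S) (hy : y ∈ S) :
    f x - g x = f y - g y := by
  refine hS.induction₂' (fun x y => f x - g x = f y - g y) ?_
    (fun x y z _ _ _ h₁ h₂ => h₁.trans h₂) hx hy
  intro x hx
  have hc : Tendsto (fun y => ((f y - g y) - (f x - g x)).im) (𝓝[S] x) (𝓝 0) := by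
    have h1 := ((hf.sub hg) x hx).sub_const (f x - g x)
    have h2 := (Complex.continuous_im.tendsto _).comp h1
    simpa [Function.comp_def] using h2
  have h3 := hc.eventually (Ioo_mem_nhds (neg_lt_zero.2 Real.pi_pos) Real.pi_pos)
  filter_upwards [h3, self_mem_nhdsWithin] with y hy hyS
  have h4 : Complex.exp ((f y - g y) - (f x - g x)) = Complex.exp 0 := by
    rw [Complex.exp_sub, Complex.exp_sub, Complex.exp_sub, h x hx, h y hyS]
    simp
  have h5 := Complex.exp_inj_of_neg_pi_lt_of_le_pi hy.1 hy.2.le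
    (by simpa using Real.pi_pos) (by simpa using Real.pi_pos.le) h4
  have h6 : f x - g x = f y - g y := (sub_eq_zero.1 h5).symm
  exact ⟨h6, h6.symm⟩

/-- A nonvanishing continuous function on the plane cannot agree with `x - p` near infinity. -/
theorem exists_zero_of_eq_sub_outside_ball {G : ℂ → ℂ} (hG : Continuous G) {p : ℂ} {R : ℝ}
    (h : ∀ x, R ≤ ‖x - p‖ → G x = x - p) : ∃ x, G x = 0 := by
  by_contra! h0
  obtain ⟨g, hgc, hg⟩ := Complex.exists_continuousOn_eqOn_exp_comp (X := ℂ) (U := univ)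
    (haveI := (convex_univ (𝕜 := ℝ) (E := ℂ)).contractibleSpace univ_nonempty
      show SimplyConnectedSpace (univ : Set ℂ) from inferInstance) isOpen_univ hG.continuousOn (by simpa using h0)
  rw [continuousOn_univ] at hgc
  set r := max R 1 with hr
  have hr0 : 0 < r := lt_of_lt_of_le one_pos (le_max_right _ _)
  have key := (isPreconnected_univ (α := ℝ)).log_sub_log_const
    (f := fun t : ℝ => g (p + r * Complex.exp (t * Complex.I)))
    (g := fun t : ℝ => (Real.log r : ℂ) + t * Complex.I)
    (by fun_prop) (by fun_prop) (fun t _ => by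
      have h1 := hg (mem_univ (p + r * Complex.exp (t * Complex.I)))
      simp only [Function.comp_apply] at h1
      rw [h1, h, Complex.exp_add, ← Complex.ofReal_exp, Real.exp_log hr0]
      · ring
      · rw [add_sub_cancel_left, norm_mul, Complex.norm_exp_ofReal_mul_I, Complex.norm_real,
          Real.norm_of_nonneg hr0.le, mul_one]
        exact le_max_left _ _) (mem_univ 0) (mem_univ (2 * Real.pi))
  simp [Complex.exp_two_pi_mul_I] at key

/-- If `D` is bounded open and `p ∈ D`, then `x - p` has no continuous logarithm along
`frontier D`. -/
theorem no_log_on_frontier {D : Set ℂ} (hb : Bornology.IsBounded D) {p : ℂ}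
    (hp : p ∈ D) {L : ℂ → ℂ} (hL : Continuous L)
    (h : ∀ x ∈ frontier D, Complex.exp (L x) = x - p) : False := by
  classical
  obtain ⟨R, hR⟩ := hb.subset_ball p
  have hG : Continuous (fun x => if x ∈ D then Complex.exp (L x) else x - p) :=
    Continuous.if (fun a ha => h a ha) (by fun_prop) (by fun_prop)
  obtain ⟨x, hx⟩ := exists_zero_of_eq_sub_outside_ball hG (p := p) (R := R) (fun x hx => by
    have : x ∉ D := fun hxD => by
      have := hR hxD
      rw [Metric.mem_ball, dist_eq_norm] at this
      linarith
    simp [this])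
  by_cases hxD : x ∈ D
  · simp [hxD] at hx
  · simp only [hxD, if_false] at hx
    exact hxD (by rwa [sub_eq_zero.1 hx])

/-- Two points in a preconnected set `N` disjoint from the compact set `K` are not separated
by `K`: the quotient `(z - b) / (z - a)` has a continuous logarithm on `K`. -/
theorem IsPreconnected.exists_log_div {N K : Set ℂ} (hN : IsPreconnected N) (hK : IsCompact K)
    (hNK : Disjoint N K) {a b : ℂ} (ha : a ∈ N) (hb : b ∈ N) :
    ∃ L : ℂ → ℂ, ContinuousOn L K ∧ ∀ z ∈ K, Complex.exp (L z) = (z - b) / (z - a) := by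
  have hne : ∀ x ∈ N, ∀ z ∈ K, z - x ≠ 0 := fun x hx z hz h0 =>
    Set.disjoint_left.1 hNK hx (by rwa [← sub_eq_zero.1 h0])
  refine hN.induction₂ (fun a b => ∃ L : ℂ → ℂ, ContinuousOn L K ∧
    ∀ z ∈ K, Complex.exp (L z) = (z - b) / (z - a)) ?_ ?_ ?_ ha hb
  · intro x hx
    have hxK : x ∈ Kᶜ := Set.disjoint_left.1 hNK hx
    obtain ⟨ε, hε, hball⟩ := Metric.isOpen_iff.1 hK.isClosed.isOpen_compl x hxK
    have : ∀ᶠ y in 𝓝[N] x, y ∈ Metric.ball x ε :=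
      mem_nhdsWithin_of_mem_nhds (Metric.ball_mem_nhds x hε)
    filter_upwards [this, self_mem_nhdsWithin] with y hy hyN
    have hslit : ∀ z ∈ K, (z - y) / (z - x) ∈ Complex.slitPlane := by
      intro z hz
      have h0 := hne x hx z hz
      have h1 : (z - y) / (z - x) = 1 + (x - y) / (z - x) := by field_simp; ring
      rw [h1]
      apply Complex.mem_slitPlane_of_norm_lt_one
      rw [norm_div, div_lt_one (norm_pos_iff.2 h0)]
      have h2 : ε ≤ ‖z - x‖ := by
        by_contra! hlt
        exact hball (by simpa [dist_eq_norm] using hlt) hz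
      have h3 : ‖x - y‖ < ε := by rw [norm_sub_rev]; simpa [dist_eq_norm] using hy
      linarith
    refine ⟨fun z => Complex.log ((z - y) / (z - x)), ?_, fun z hz => ?_⟩
    · refine ContinuousOn.clog (ContinuousOn.div (by fun_prop) (by fun_prop) (hne x hx)) hslit
    · exact Complex.exp_log (div_ne_zero (hne y hyN z hz) (hne x hx z hz))
  · rintro x y z hx hy hz ⟨L, hL, hL'⟩ ⟨M, hM, hM'⟩
    refine ⟨fun z => L z + M z, hL.add hM, fun w hw => ?_⟩
    have := hne y hy w hw
    rw [Complex.exp_add, hL' w hw, hM' w hw]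
    field_simp
  · rintro x y hx hy ⟨L, hL, hL'⟩
    refine ⟨fun z => -L z, hL.neg, fun w hw => ?_⟩
    rw [Complex.exp_neg, hL' w hw, inv_div]

theorem Complex.ofReal_add_ofReal_mul_exp_mem_slitPlane {r t β : ℝ} (hr : 0 ≤ r) (ht : 0 < t)
    (hβ : |β| < Real.pi) :
    (r : ℂ) + t * Complex.exp (β * Complex.I) ∈ Complex.slitPlane := by
  have h : Complex.exp (β * Complex.I) ∈ Complex.slitPlane := by
    rw [abs_lt] at hβ
    rw [Complex.mem_slitPlane_iff_arg, Complex.arg_exp_mul_I,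
      (toIocMod_eq_self Real.two_pi_pos).2 ⟨hβ.1, by linarith⟩]
    exact ⟨hβ.2.ne, Complex.exp_ne_zero _⟩
  rw [Complex.mem_slitPlane_iff] at h ⊢
  simp only [Complex.add_re, Complex.add_im, Complex.ofReal_re, Complex.ofReal_im, zero_add,
    Complex.re_ofReal_mul, Complex.im_ofReal_mul]
  rcases h with h | h
  · exact Or.inl (by positivity)
  · exact Or.inr (mul_ne_zero ht.ne' h)

/-- The variation, along a segment of direction `α` issuing from `p`, of a logarithm of the
quotient of `z - (p + t * exp (γ * I))` by `z - (p + t * exp (δ * I))`. -/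
theorem log_div_along_ray {L : ℂ → ℂ} {p : ℂ} {ε t α β γ β' δ : ℝ} (hε : 0 ≤ ε) (ht : 0 < t)
    (hβ : |β| < Real.pi) (hβ' : |β'| < Real.pi)
    (hγ : Complex.exp (γ * Complex.I) = - Complex.exp (α * Complex.I + β * Complex.I))
    (hδ : Complex.exp (δ * Complex.I) = - Complex.exp (α * Complex.I + β' * Complex.I))
    (hL : ContinuousOn (fun r : ℝ => L (p + r * Complex.exp (α * Complex.I))) (Icc 0 ε))
    (h : ∀ r : ℝ, r ∈ Icc 0 ε → Complex.exp (L (p + r * Complex.exp (α * Complex.I))) =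
      ((p + r * Complex.exp (α * Complex.I)) - (p + t * Complex.exp (γ * Complex.I))) /
        ((p + r * Complex.exp (α * Complex.I)) - (p + t * Complex.exp (δ * Complex.I)))) :
    L (p + ε * Complex.exp (α * Complex.I)) - (Complex.log (ε + t * Complex.exp (β * Complex.I)) -
      Complex.log (ε + t * Complex.exp (β' * Complex.I))) = L p - (β - β') * Complex.I := by
  have hs : ∀ r ∈ Icc 0 ε, ∀ β : ℝ, |β| < Real.pi →
      (r : ℂ) + t * Complex.exp (β * Complex.I) ∈ Complex.slitPlane := fun r hr β hβ =>
    Complex.ofReal_add_ofReal_mul_exp_mem_slitPlane hr.1 ht hβ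
  have key := (isPreconnected_Icc (a := (0 : ℝ)) (b := ε)).log_sub_log_const
    (f := fun r : ℝ => L (p + r * Complex.exp (α * Complex.I)))
    (g := fun r : ℝ => Complex.log (r + t * Complex.exp (β * Complex.I)) -
      Complex.log (r + t * Complex.exp (β' * Complex.I))) hL
    (ContinuousOn.sub (ContinuousOn.clog (by fun_prop) (fun r hr => hs r hr β hβ))
      (ContinuousOn.clog (by fun_prop) (fun r hr => hs r hr β' hβ')))
    (fun r hr => by
      have h1 := Complex.slitPlane_ne_zero (hs r hr β hβ)
      have h2 := Complex.slitPlane_ne_zero (hs r hr β' hβ')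
      have h3 := Complex.exp_ne_zero (α * Complex.I)
      rw [h r hr, Complex.exp_sub, Complex.exp_log h1, Complex.exp_log h2, hγ, hδ,
        Complex.exp_add, Complex.exp_add, ← mul_div_mul_left
          ((r : ℂ) + t * Complex.exp (β * Complex.I)) (r + t * Complex.exp (β' * Complex.I)) h3]
      congr 1 <;> ring)
    (right_mem_Icc.2 hε) (left_mem_Icc.2 hε)
  have hlog : ∀ β : ℝ, |β| < Real.pi → Complex.log (t * Complex.exp (β * Complex.I)) =
      Real.log t + β * Complex.I := fun β hβ => by
    rw [abs_lt] at hβ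
    rw [Complex.log_ofReal_mul ht (Complex.exp_ne_zero _), Complex.log_exp]
    · simpa using hβ.1
    · simpa using hβ.2.le
  simp only [Complex.ofReal_zero, zero_mul, add_zero, zero_add] at key
  rw [key, hlog β hβ, hlog β' hβ']
  ring

theorem Complex.exp_mul_I_eq_neg_exp {γ α β : ℝ} (h : γ = α + β + Real.pi) :
    Complex.exp (γ * Complex.I) = - Complex.exp (α * Complex.I + β * Complex.I) := by
  subst h
  push_cast
  rw [add_mul, add_mul, Complex.exp_add _ (Real.pi * Complex.I), Complex.exp_pi_mul_I]
  ring

theorem Complex.exp_mul_I_eq_neg_exp' {γ α β : ℝ} (h : γ = α + β - Real.pi) :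
    Complex.exp (γ * Complex.I) = - Complex.exp (α * Complex.I + β * Complex.I) := by
  rw [← Complex.exp_mul_I_eq_neg_exp (γ := γ + 2 * Real.pi) (by rw [h]; ring)]
  push_cast
  rw [add_mul, Complex.exp_add, Complex.exp_two_pi_mul_I, mul_one]

/-- A closed connected set joined to `p` along two rays separates the two sectors at `p` cut out
by these rays. -/
theorem false_of_crossing {K N : Set ℂ} (hK : IsCompact K) (hKc : IsPreconnected K) {p : ℂ}
    (hp : p ∉ K) {ε ε' α₁ α₂ α₃ α₄ : ℝ} (hε : 0 < ε) (hε' : 0 < ε') (h12 : α₁ < α₂) (h23 : α₂ < α₃)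
    (h34 : α₃ < α₄) (h41 : α₄ < α₁ + 2 * Real.pi)
    (h1 : p + ε * Complex.exp (α₁ * Complex.I) ∈ K)
    (h3 : p + ε' * Complex.exp (α₃ * Complex.I) ∈ K)
    (hN : IsPreconnected N) (hNK : Disjoint N K)
    (hN1 : ∀ r : ℝ, r ∈ Icc 0 ε → p + r * Complex.exp (α₁ * Complex.I) ∉ N)
    (hN3 : ∀ r : ℝ, r ∈ Icc 0 ε' → p + r * Complex.exp (α₃ * Complex.I) ∉ N)
    (h2 : ∀ᶠ t : ℝ in 𝓝[>] 0, p + t * Complex.exp (α₂ * Complex.I) ∈ N)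
    (h4 : ∀ᶠ t : ℝ in 𝓝[>] 0, p + t * Complex.exp (α₄ * Complex.I) ∈ N) : False := by
  set s₁ := p + ε * Complex.exp (α₁ * Complex.I) with hs₁
  set s₃ := p + ε' * Complex.exp (α₃ * Complex.I) with hs₃
  set b : ℝ → ℂ := fun t => p + t * Complex.exp (α₂ * Complex.I) with hb
  set a : ℝ → ℂ := fun t => p + t * Complex.exp (α₄ * Complex.I) with ha
  set S₁ := (fun r : ℝ => p + r * Complex.exp (α₁ * Complex.I)) '' Icc 0 ε with hS₁
  set S₃ := (fun r : ℝ => p + r * Complex.exp (α₃ * Complex.I)) '' Icc 0 ε' with hS₃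
  set K' := K ∪ (S₁ ∪ S₃) with hK'
  have hK'c : IsCompact K' := hK.union ((isCompact_Icc.image (by fun_prop)).union
    (isCompact_Icc.image (by fun_prop)))
  have hNK' : Disjoint N K' := by
    rw [Set.disjoint_left] at hNK ⊢
    rintro x hx (h | ⟨r, hr, rfl⟩ | ⟨r, hr, rfl⟩)
    · exact hNK hx h
    · exact hN1 r hr hx
    · exact hN3 r hr hx
  obtain ⟨ρ, hρ, hball⟩ := Metric.isOpen_iff.1 hK.isClosed.isOpen_compl p hp
  have hsmall : ∀ᶠ t : ℝ in 𝓝[>] 0, t < ρ / 4 :=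
    mem_nhdsWithin_of_mem_nhds (Iio_mem_nhds (by positivity))
  set R : ℝ → ℂ := fun t =>
    ((Complex.log (ε' + t * Complex.exp ((α₂ - α₃ + Real.pi : ℝ) * Complex.I)) -
      Complex.log (ε' + t * Complex.exp ((α₄ - α₃ - Real.pi : ℝ) * Complex.I))) -
        Complex.log ((s₃ - b t) / (s₃ - a t))) -
    ((Complex.log (ε + t * Complex.exp ((α₂ - α₁ - Real.pi : ℝ) * Complex.I)) -
      Complex.log (ε + t * Complex.exp ((α₄ - α₁ - Real.pi : ℝ) * Complex.I))) -
        Complex.log ((s₁ - b t) / (s₁ - a t))) with hR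
  have hval : ∀ᶠ t : ℝ in 𝓝[>] 0, R t = 2 * Real.pi * Complex.I := by
    filter_upwards [h2, h4, hsmall, self_mem_nhdsWithin] with t ht2 ht4 hts (ht0 : 0 < t)
    obtain ⟨L, hL, hexp⟩ := hN.exists_log_div hK'c hNK' ht4 ht2
    have hzK : ∀ z ∈ K, ρ ≤ ‖z - p‖ := fun z hz => by
      by_contra! hlt
      exact hball (by simpa [dist_eq_norm] using hlt) hz
    have hne : ∀ x ∈ N, ∀ z ∈ K', z - x ≠ 0 := fun x hx z hz h0 =>
      Set.disjoint_left.1 hNK' hx (by rwa [← sub_eq_zero.1 h0])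
    have e1 := hKc.log_sub_log_const (hL.mono subset_union_left)
      (g := fun z => Complex.log ((z - b t) / (z - a t)))
      (ContinuousOn.clog (ContinuousOn.div (by fun_prop) (by fun_prop)
        (fun z hz => hne _ ht4 z (Or.inl hz))) (fun z hz => by
          have h0 : z - a t ≠ 0 := hne _ ht4 z (Or.inl hz)
          have h1 : (z - b t) / (z - a t) = 1 + (a t - b t) / (z - a t) := by field_simp; ring
          rw [h1]
          apply Complex.mem_slitPlane_of_norm_lt_one
          rw [norm_div, div_lt_one (norm_pos_iff.2 h0)]
          have na : ‖a t - p‖ = t := by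
            simp [ha, Complex.norm_exp_ofReal_mul_I, abs_of_pos ht0]
          have nb : ‖b t - p‖ = t := by
            simp [hb, Complex.norm_exp_ofReal_mul_I, abs_of_pos ht0]
          have n1 : ‖a t - b t‖ ≤ ‖a t - p‖ + ‖b t - p‖ := by
            rw [show a t - b t = (a t - p) - (b t - p) by ring]; exact norm_sub_le _ _
          have n2 : ‖z - p‖ ≤ ‖z - a t‖ + ‖a t - p‖ := by
            rw [show z - p = (z - a t) + (a t - p) by ring]; exact norm_add_le _ _
          have := hzK z hz
          linarith))
      (fun z hz => by
        rw [hexp z (Or.inl hz), Complex.exp_log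
          (div_ne_zero (hne _ ht2 z (Or.inl hz)) (hne _ ht4 z (Or.inl hz)))]) h1 h3
    have e2 := log_div_along_ray (L := L) (p := p) (ε := ε) (t := t) (α := α₁) (γ := α₂) (δ := α₄)
      (β := α₂ - α₁ - Real.pi) (β' := α₄ - α₁ - Real.pi) hε.le ht0
      (by rw [abs_lt]; constructor <;> linarith) (by rw [abs_lt]; constructor <;> linarith)
      (Complex.exp_mul_I_eq_neg_exp (by ring)) (Complex.exp_mul_I_eq_neg_exp (by ring))
      (hL.comp (by fun_prop) (fun r hr => Or.inr (Or.inl ⟨r, hr, rfl⟩)))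
      (fun r hr => hexp _ (Or.inr (Or.inl ⟨r, hr, rfl⟩)))
    have e3 := log_div_along_ray (L := L) (p := p) (ε := ε') (t := t) (α := α₃) (γ := α₂) (δ := α₄)
      (β := α₂ - α₃ + Real.pi) (β' := α₄ - α₃ - Real.pi) hε'.le ht0
      (by rw [abs_lt]; constructor <;> linarith) (by rw [abs_lt]; constructor <;> linarith)
      (Complex.exp_mul_I_eq_neg_exp' (by ring)) (Complex.exp_mul_I_eq_neg_exp (by ring))
      (hL.comp (by fun_prop) (fun r hr => Or.inr (Or.inr ⟨r, hr, rfl⟩)))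
      (fun r hr => hexp _ (Or.inr (Or.inr ⟨r, hr, rfl⟩)))
    simp only [← hs₁, ← hs₃] at e1 e2 e3
    simp only [hR]
    push_cast at e2 e3 ⊢
    linear_combination -e1 + e2 - e3
  have hlim : Tendsto R (𝓝[>] 0) (𝓝 0) := by
    have c1 : ∀ (η : ℝ), 0 < η → ∀ β : ℝ, Tendsto (fun t : ℝ =>
        Complex.log (η + t * Complex.exp (β * Complex.I))) (𝓝[>] 0) (𝓝 (Complex.log η)) := by
      intro η hη β
      have : ContinuousAt (fun t : ℝ => Complex.log (η + t * Complex.exp (β * Complex.I))) 0 := by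
        refine ContinuousAt.clog (by fun_prop) ?_
        simp [Complex.ofReal_mem_slitPlane, hη]
      simpa using this.tendsto.mono_left nhdsWithin_le_nhds
    have c2 : ∀ s : ℂ, s ∈ K → Tendsto (fun t : ℝ =>
        Complex.log ((s - b t) / (s - a t))) (𝓝[>] 0) (𝓝 0) := by
      intro s hs
      have hsp : s - p ≠ 0 := fun h0 => hp (by rwa [← sub_eq_zero.1 h0])
      have : ContinuousAt (fun t : ℝ => Complex.log ((s - b t) / (s - a t))) 0 := by
        refine ContinuousAt.clog (ContinuousAt.div (by fun_prop) (by fun_prop) ?_) ?_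
        · simpa [ha] using hsp
        · simp [ha, hb, hsp]
      simpa [ha, hb, hsp] using this.tendsto.mono_left nhdsWithin_le_nhds
    have := ((((c1 ε' hε' (α₂ - α₃ + Real.pi)).sub (c1 ε' hε' (α₄ - α₃ - Real.pi))).sub
      (c2 s₃ h3))).sub (((c1 ε hε (α₂ - α₁ - Real.pi)).sub (c1 ε hε (α₄ - α₁ - Real.pi))).sub
      (c2 s₁ h1))
    simpa [hR] using this
  have := tendsto_nhds_unique (hlim.congr' hval) tendsto_const_nhds
  simp [Real.pi_ne_zero, Complex.I_ne_zero] at this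

open InnerProductSpace in
/-- A real harmonic function with a local maximum is locally constant. -/
theorem InnerProductSpace.HarmonicAt.eventually_eq_of_isLocalMax_s14 {h : ℂ → ℝ} {p : ℂ} (hh : HarmonicAt h p)
    (hm : IsLocalMax h p) : ∀ᶠ z in 𝓝 p, h z = h p := by
  obtain ⟨ε, hε, hball⟩ := Metric.eventually_nhds_iff_ball.1 hh.eventually
  obtain ⟨f, hf, hfe⟩ := HarmonicOnNhd.exists_analyticOnNhd_ball_re_eq (z := p) (R := ε)
    (f := h) hball
  have hnorm : ∀ z ∈ Metric.ball p ε, ‖Complex.exp (f z)‖ = Real.exp (h z) := fun z hz => by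
    rw [Complex.norm_exp, ← hfe hz]
  have hb := Metric.ball_mem_nhds p hε
  have key := Complex.eventually_eq_of_isLocalMax_norm (f := fun z => Complex.exp (f z)) (c := p)
    (by filter_upwards [hb] with z hz using (hf z hz).differentiableAt.cexp)
    (by
      filter_upwards [hb, hm] with z hz hz'
      simp only [Function.comp_apply]
      rw [hnorm z hz, hnorm p (Metric.mem_ball_self hε)]
      exact Real.exp_le_exp.2 hz')
  filter_upwards [hb, key] with z hz hz'
  apply Real.exp_injective
  rw [← hnorm z hz, ← hnorm p (Metric.mem_ball_self hε), hz']

open InnerProductSpace in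
/-- At a critical zero, a nontrivial real harmonic function changes sign at least four times
along small circles. -/
theorem InnerProductSpace.HarmonicAt.exists_alternating_rays {h : ℂ → ℝ} {p : ℂ} (hh : HarmonicAt h p)
    (h0 : h p = 0) (hd : fderiv ℝ h p = 0) (hne : ¬ ∀ᶠ z in 𝓝 p, h z = 0) :
    ∃ α₁ α₂ α₃ α₄ : ℝ, α₁ < α₂ ∧ α₂ < α₃ ∧ α₃ < α₄ ∧ α₄ < α₁ + 2 * Real.pi ∧
      ∀ᶠ t : ℝ in 𝓝[>] 0, 0 < h (p + t * Complex.exp (α₁ * Complex.I)) ∧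
        h (p + t * Complex.exp (α₂ * Complex.I)) < 0 ∧
        0 < h (p + t * Complex.exp (α₃ * Complex.I)) ∧
        h (p + t * Complex.exp (α₄ * Complex.I)) < 0 := by
  obtain ⟨ε, hε, hball⟩ := Metric.eventually_nhds_iff_ball.1 hh.eventually
  obtain ⟨f, hf, hfe⟩ := HarmonicOnNhd.exists_analyticOnNhd_ball_re_eq (z := p) (R := ε)
    (f := h) hball
  have hpb := Metric.mem_ball_self (x := p) hε
  have hb := Metric.ball_mem_nhds p hε
  have hfe' : ∀ z ∈ Metric.ball p ε, h z = (f z - f p).re := fun z hz => by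
    have h1 : (f z).re = h z := hfe hz
    have h2 : (f p).re = h p := hfe hpb
    rw [Complex.sub_re, h1, h2, h0, sub_zero]
  have hF : AnalyticAt ℂ (fun z => f z - f p) p := (hf p hpb).sub analyticAt_const
  obtain ⟨m, g, hg, hg0, hfg⟩ := hF.exists_eventuallyEq_pow_smul_nonzero_iff.2 (fun hc => hne (by
    filter_upwards [hb, hc] with z hz hz'
    rw [hfe' z hz, hz', Complex.zero_re]))
  set β := (g p).arg with hβ
  have hray : ∀ α : ℝ, Tendsto (fun t : ℝ => p + t * Complex.exp (α * Complex.I)) (𝓝[>] 0)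
      (𝓝 p) := fun α => by
    have : Continuous (fun t : ℝ => p + t * Complex.exp (α * Complex.I)) := by fun_prop
    simpa using (this.tendsto 0).mono_left nhdsWithin_le_nhds
  have hasym : ∀ α : ℝ, Tendsto (fun t : ℝ => h (p + t * Complex.exp (α * Complex.I)) / t ^ m)
      (𝓝[>] 0) (𝓝 (‖g p‖ * Real.cos (m * α + β))) := by
    intro α
    have h1 : Tendsto (fun t : ℝ => (Complex.exp (α * Complex.I) ^ m *
        g (p + t * Complex.exp (α * Complex.I))).re) (𝓝[>] 0)
        (𝓝 (Complex.exp (α * Complex.I) ^ m * g p).re) :=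
      (Complex.continuous_re.tendsto _).comp
        ((hg.continuousAt.tendsto.comp (hray α)).const_mul _)
    have h2 : (Complex.exp (α * Complex.I) ^ m * g p).re = ‖g p‖ * Real.cos (m * α + β) := by
      have h3 : Complex.exp (α * Complex.I) ^ m * g p =
          (‖g p‖ : ℂ) * Complex.exp (((m * α + β : ℝ) : ℂ) * Complex.I) := by
        conv_lhs => rw [← Complex.norm_mul_exp_arg_mul_I (g p)]
        rw [← Complex.exp_nat_mul]
        push_cast
        rw [add_mul, Complex.exp_add, ← hβ]
        ring_nf
      rw [h3, Complex.re_ofReal_mul, Complex.exp_ofReal_mul_I_re]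
    rw [← h2]
    refine h1.congr' ?_
    filter_upwards [(hray α).eventually hb, (hray α).eventually hfg, self_mem_nhdsWithin]
      with t ht1 ht2 (ht : 0 < t)
    rw [hfe' _ ht1, ht2, add_sub_cancel_left, mul_pow, smul_eq_mul, mul_assoc, ← Complex.ofReal_pow,
      Complex.re_ofReal_mul, mul_div_cancel_left₀ _ (pow_pos ht m).ne']
  have hgn : 0 < ‖g p‖ := norm_pos_iff.2 hg0
  have hm0 : m ≠ 0 := fun hm => by
    have := hfg.self_of_nhds
    simp [hm] at this
    exact hg0 this.symm
  have hm1 : m ≠ 1 := fun hm => by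
    have h1 : HasFDerivAt h (0 : ℂ →L[ℝ] ℝ) p := by
      rw [← hd]
      exact (hh.1.differentiableAt (by norm_num)).hasFDerivAt
    have h2 : HasDerivAt (fun t : ℝ => p + t * Complex.exp ((-β : ℝ) * Complex.I))
        (Complex.exp ((-β : ℝ) * Complex.I)) 0 := by
      simpa using ((Complex.ofRealCLM.hasDerivAt (x := 0)).mul_const
        (Complex.exp ((-β : ℝ) * Complex.I))).const_add p
    have h3 := HasFDerivAt.comp_hasDerivAt (x := (0 : ℝ))
      (l := h) (l' := (0 : ℂ →L[ℝ] ℝ)) (by simpa using h1) h2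
    have h4 := (hasDerivAt_iff_tendsto_slope_zero.1 h3).mono_left
      (nhdsWithin_mono 0 (s := Ioi 0) (fun x (hx : 0 < x) => hx.ne'))
    have h5 := tendsto_nhds_unique (h4.congr (fun t => by
      simp [h0]; rfl)) ((hasym (-β)).congr (fun t => by rw [hm, pow_one, div_eq_inv_mul]; simp))
    simp [hm] at h5
    exact hgn.ne h5
  have hm2 : (2 : ℝ) ≤ m := by exact_mod_cast (show 2 ≤ m by omega)
  have hmp : (0 : ℝ) < m := by linarith
  have hpi := Real.pi_pos
  have hsign : ∀ α : ℝ, Real.cos (m * α + β) = 1 →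
      ∀ᶠ t : ℝ in 𝓝[>] 0, 0 < h (p + t * Complex.exp (α * Complex.I)) := fun α hα => by
    have h1 := hasym α
    rw [hα, mul_one] at h1
    filter_upwards [h1.eventually (lt_mem_nhds hgn), self_mem_nhdsWithin] with t ht (ht0 : 0 < t)
    exact (div_pos_iff_of_pos_right (pow_pos ht0 m)).1 ht
  have hsign' : ∀ α : ℝ, Real.cos (m * α + β) = -1 →
      ∀ᶠ t : ℝ in 𝓝[>] 0, h (p + t * Complex.exp (α * Complex.I)) < 0 := fun α hα => by
    have h1 := hasym α
    rw [hα, mul_neg_one] at h1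
    filter_upwards [h1.eventually (gt_mem_nhds (neg_lt_zero.2 hgn)), self_mem_nhdsWithin]
      with t ht (ht0 : 0 < t)
    exact not_le.1 fun hc => not_le.2 ht (div_nonneg hc (pow_pos ht0 m).le)
  refine ⟨-β / m, (Real.pi - β) / m, (2 * Real.pi - β) / m, (3 * Real.pi - β) / m, ?_, ?_, ?_, ?_,
    ?_⟩
  · gcongr; linarith
  · gcongr; linarith
  · gcongr; linarith
  · rw [div_add' _ _ _ hmp.ne']
    gcongr
    nlinarith
  · have e : ∀ x : ℝ, m * ((x - β) / m) + β = x := fun x => by field_simp; ring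
    filter_upwards [hsign (-β / m) (by
        rw [show (m : ℝ) * (-β / m) + β = 0 by field_simp; ring, Real.cos_zero]),
      hsign' ((Real.pi - β) / m) (by rw [e, Real.cos_pi]),
      hsign ((2 * Real.pi - β) / m) (by rw [e, Real.cos_two_pi]),
      hsign' ((3 * Real.pi - β) / m) (by
        rw [e, show 3 * Real.pi = Real.pi + 2 * Real.pi by ring, Real.cos_add_two_pi,
          Real.cos_pi])] with t h1 h2 h3 h4 using ⟨h1, h2, h3, h4⟩

open InnerProductSpace in
/-- By the maximum principle, superlevel sets of harmonic functions have no component away from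
the boundary. -/
theorem isPreconnected_superlevel {V : Set ℂ} (hV : IsCompact V) {h : ℂ → ℝ}
    (hc : ContinuousOn h V) (hh : ∀ p ∈ interior V, HarmonicAt h p) {δ : ℝ}
    (hb : IsPreconnected {x | x ∈ frontier V ∧ δ ≤ h x}) :
    IsPreconnected {x | x ∈ V ∧ δ ≤ h x} := by
  have hfV : frontier V ⊆ V := hV.isClosed.frontier_subset
  have hS : IsClosed {x | x ∈ V ∧ δ ≤ h x} :=
    hc.preimage_isClosed_of_isClosed hV.isClosed isClosed_Ici
  have hbS : IsClosed {x | x ∈ frontier V ∧ δ ≤ h x} :=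
    (hc.mono hfV).preimage_isClosed_of_isClosed isClosed_frontier isClosed_Ici
  have key : ∀ A B : Set ℂ, IsClosed A → IsClosed B → {x | x ∈ V ∧ δ ≤ h x} ⊆ A ∪ B →
      Disjoint A B → {x | x ∈ frontier V ∧ δ ≤ h x} ⊆ A → {x | x ∈ V ∧ δ ≤ h x} ⊆ A := by
    intro A B hA hB hAB hd hbA x hx
    by_contra hxA
    set T := {x | x ∈ V ∧ δ ≤ h x} ∩ B with hT
    have hTne : T.Nonempty := ⟨x, hx, (hAB hx).resolve_left hxA⟩
    have hTc : IsCompact T := hV.of_isClosed_subset (hS.inter hB) (fun y hy => hy.1.1)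
    have hTi : T ⊆ interior V := fun y hy => by
      by_contra hyi
      have hyf : y ∈ frontier V := ⟨subset_closure hy.1.1, hyi⟩
      exact Set.disjoint_left.1 hd (hbA ⟨hyf, hy.1.2⟩) hy.2
    obtain ⟨x₀, hx₀, hmax⟩ := hTc.exists_isMaxOn hTne (hc.mono (fun y hy => hy.1.1))
    have hZc : IsClosed {y | y ∈ T ∧ h y = h x₀} :=
      (hc.mono (fun y hy => hy.1.1)).preimage_isClosed_of_isClosed hTc.isClosed
        (isClosed_singleton (x := h x₀))
    have hZo : IsOpen {y | y ∈ T ∧ h y = h x₀} := by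
      rw [isOpen_iff_mem_nhds]
      rintro y ⟨hyT, hy⟩
      have hyA : y ∉ A := fun hyA => Set.disjoint_left.1 hd hyA hyT.2
      have hn : ∀ᶠ z in 𝓝 y, z ∈ V ∧ z ∉ A :=
        (show ∀ᶠ z in 𝓝 y, z ∈ V from mem_interior_iff_mem_nhds.1 (hTi hyT)).and (hA.isOpen_compl.mem_nhds hyA)
      have hloc : IsLocalMax h y := by
        filter_upwards [hn] with z ⟨hzV, hzA⟩
        rw [hy]
        rcases le_or_gt δ (h z) with hz | hz
        · exact hmax ⟨⟨hzV, hz⟩, (hAB ⟨hzV, hz⟩).resolve_left hzA⟩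
        · exact hz.le.trans hx₀.1.2
      filter_upwards [hn, (hh y (hTi hyT)).eventually_eq_of_isLocalMax_s14 hloc] with z ⟨hzV, hzA⟩ hz
      have hzδ : δ ≤ h z := by rw [hz]; exact hyT.1.2
      exact ⟨⟨⟨hzV, hzδ⟩, (hAB ⟨hzV, hzδ⟩).resolve_left hzA⟩, hz.trans hy⟩
    rcases isClopen_iff.1 ⟨hZc, hZo⟩ with he | hu
    · exact (he ▸ (⟨hx₀, rfl⟩ : x₀ ∈ {y | y ∈ T ∧ h y = h x₀}) : x₀ ∈ (∅ : Set ℂ))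
    · have hTu : T = univ := univ_subset_iff.1 (hu ▸ fun y hy => hy.1)
      exact noncompact_univ ℂ (hTu ▸ hTc)
  rw [isPreconnected_iff_subset_of_fully_disjoint_closed hS]
  intro A B hA hB hAB hd
  rcases (isPreconnected_iff_subset_of_fully_disjoint_closed hbS).1 hb A B hA hB
    (fun x hx => hAB ⟨hfV hx.1, hx.2⟩) hd with h1 | h1
  · exact Or.inl (key A B hA hB hAB hd h1)
  · exact Or.inr (key B A hB hA (union_comm A B ▸ hAB) hd.symm h1)

open InnerProductSpace in
theorem isPreconnected_strict_superlevel {V : Set ℂ} (hV : IsCompact V) {h : ℂ → ℝ}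
    (hc : ContinuousOn h V) (hh : ∀ p ∈ interior V, HarmonicAt h p) {c : ℝ}
    (hb : ∀ δ, (∃ x ∈ V, δ < h x) → (∃ x ∈ V, h x < δ) →
      IsPreconnected {x | x ∈ frontier V ∧ δ ≤ h x}) (hne : ∃ x ∈ V, h x ≤ c) :
    IsPreconnected {x | x ∈ V ∧ c < h x} := by
  obtain ⟨q, hqV, hq⟩ := hne
  refine isPreconnected_of_forall_pair fun x hx y hy => ?_
  obtain ⟨δ, hδ1, hδ2⟩ := exists_between (lt_min hx.2 hy.2)
  have hδx := hδ2.trans_le (min_le_left _ _)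
  have hδy := hδ2.trans_le (min_le_right _ _)
  exact ⟨{x | x ∈ V ∧ δ ≤ h x}, fun z hz => ⟨hz.1, hδ1.trans_le hz.2⟩, ⟨hx.1, hδx.le⟩,
    ⟨hy.1, hδy.le⟩, isPreconnected_superlevel hV hc hh
      (hb δ ⟨x, hx.1, hδx⟩ ⟨q, hqV, hq.trans_lt hδ1⟩)⟩

open InnerProductSpace in
theorem not_eventually_eq_of_not_const_on_frontier {V : Set ℂ} (hV : IsCompact V) {h : ℂ → ℝ}
    (hc : ContinuousOn h V) (hh : ∀ p ∈ interior V, HarmonicAt h p)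
    (hbd : ∀ c, ∃ x ∈ frontier V, h x ≠ c)
    (harc : ∀ D : Set ℂ, IsOpen D → Bornology.IsBounded D → ∀ p ∈ D, p ∈ interior V →
      frontier D ⊆ frontier V → frontier V ⊆ frontier D) {p : ℂ} (hp : p ∈ interior V) (c : ℝ) :
    ¬ ∀ᶠ z in 𝓝 p, h z = c := by
  intro hev
  set D := {z | z ∈ interior V ∧ ∀ᶠ y in 𝓝 z, h y = c} with hD
  have hDo : IsOpen D := isOpen_interior.inter isOpen_setOfPred_eventually_nhds
  have hDV : D ⊆ V := fun z hz => interior_subset hz.1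
  have hfr : frontier D ⊆ frontier V := by
    intro x hx
    have hxV : x ∈ V := closure_minimal hDV hV.isClosed hx.1
    refine ⟨subset_closure hxV, fun hxi => ?_⟩
    obtain ⟨ε, hε, hball⟩ := Metric.isOpen_iff.1 isOpen_interior x hxi
    obtain ⟨y, hyD, hy⟩ := Metric.mem_closure_iff.1 hx.1 ε hε
    have hyb : y ∈ Metric.ball x ε := by rwa [Metric.mem_ball, dist_comm]
    have han : AnalyticOnNhd ℝ h (Metric.ball x ε) := fun z hz => _root_.HarmonicAt.analyticAt (hh z (hball hz))
    have heq := han.eqOn_of_preconnected_of_eventuallyEq (g := fun _ => c)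
      analyticOnNhd_const (convex_ball x ε).isPreconnected hyb hyD.2
    have hxD : x ∈ D := ⟨hxi, by
      filter_upwards [Metric.ball_mem_nhds x hε] with z hz using heq hz⟩
    exact hx.2 (hDo.interior_eq.symm ▸ hxD)
  have hpD : p ∈ D := ⟨hp, hev⟩
  have hfr' := harc D hDo (hV.isBounded.subset hDV) p hpD hp hfr
  obtain ⟨x, hx, hxc⟩ := hbd c
  have hxV : x ∈ V := hV.isClosed.frontier_subset hx
  have hcl : IsClosed {z | z ∈ V ∧ h z = c} :=
    hc.preimage_isClosed_of_isClosed hV.isClosed (isClosed_singleton (x := c))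
  have hsub : D ⊆ {z | z ∈ V ∧ h z = c} := fun z hz => ⟨hDV hz, hz.2.self_of_nhds⟩
  exact hxc (closure_minimal hsub hcl (hfr' hx).1).2

open InnerProductSpace in
theorem fderiv_ne_zero_of_isPreconnected_levels {V : Set ℂ} (hV : IsCompact V) {h : ℂ → ℝ}
    (hc : ContinuousOn h V) (hh : ∀ p ∈ interior V, HarmonicAt h p)
    (hbd : ∀ c, ∃ x ∈ frontier V, h x ≠ c)
    (harc : ∀ D : Set ℂ, IsOpen D → Bornology.IsBounded D → ∀ p ∈ D, p ∈ interior V →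
      frontier D ⊆ frontier V → frontier V ⊆ frontier D)
    (hup : ∀ δ, (∃ x ∈ V, δ < h x) → (∃ x ∈ V, h x < δ) →
      IsPreconnected {x | x ∈ frontier V ∧ δ ≤ h x})
    (hdown : ∀ δ, (∃ x ∈ V, δ < h x) → (∃ x ∈ V, h x < δ) →
      IsPreconnected {x | x ∈ frontier V ∧ h x ≤ δ})
    {p : ℂ} (hp : p ∈ interior V) : fderiv ℝ h p ≠ 0 := by
  intro hd
  have hpV := interior_subset hp
  have hh' : HarmonicAt (h - fun _ => h p) p := (hh p hp).sub (harmonicAt_const _)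
  obtain ⟨α₁, α₂, α₃, α₄, h12, h23, h34, h41, hev⟩ := hh'.exists_alternating_rays (by simp)
    (by
      rw [show (h - fun _ => h p) = fun z => h z - h p from rfl, fderiv_sub_const, hd])
    (fun hc0 => not_eventually_eq_of_not_const_on_frontier hV hc hh hbd harc hp (h p) (by
      filter_upwards [hc0] with z hz using sub_eq_zero.1 hz))
  simp only [Pi.sub_apply, sub_pos, sub_neg] at hev
  have hray : ∀ α : ℝ, ∀ᶠ t : ℝ in 𝓝[>] 0, p + t * Complex.exp (α * Complex.I) ∈ V := fun α => by
    have hc : Continuous (fun t : ℝ => p + t * Complex.exp (α * Complex.I)) := by fun_prop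
    have : Tendsto (fun t : ℝ => p + t * Complex.exp (α * Complex.I)) (𝓝[>] 0) (𝓝 p) := by
      simpa using (hc.tendsto 0).mono_left nhdsWithin_le_nhds
    exact this.eventually (mem_interior_iff_mem_nhds.1 hp)
  obtain ⟨ε, hε, hall⟩ := (mem_nhdsGT_iff_exists_Ioc_subset).1
    ((hev.and (hray α₁)).and (hray α₃))
  have hε0 : (0 : ℝ) < ε := hε
  have hεm := hall (right_mem_Ioc.2 hε0)
  set δ := (h p + min (h (p + ε * Complex.exp (α₁ * Complex.I)))
    (h (p + ε * Complex.exp (α₃ * Complex.I)))) / 2 with hδ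
  have hmin := lt_min hεm.1.1.1 hεm.1.1.2.2.1
  have hm1 := min_le_left (h (p + ε * Complex.exp (α₁ * Complex.I)))
    (h (p + ε * Complex.exp (α₃ * Complex.I)))
  have hm3 := min_le_right (h (p + ε * Complex.exp (α₁ * Complex.I)))
    (h (p + ε * Complex.exp (α₃ * Complex.I)))
  have hK : IsCompact {x | x ∈ V ∧ δ ≤ h x} := hV.of_isClosed_subset
    (hc.preimage_isClosed_of_isClosed hV.isClosed isClosed_Ici) (fun y hy => hy.1)
  have hKc := isPreconnected_superlevel hV hc hh (hup δ ⟨_, hεm.1.2, by linarith⟩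
    ⟨p, hpV, by linarith⟩)
  have hNc := isPreconnected_strict_superlevel (h := -h) hV hc.neg (fun p hp => (hh p hp).neg)
    (c := -h p) (fun η hη1 hη2 => by
      have := hdown (-η) (by
        obtain ⟨x, hx, hx'⟩ := hη2
        exact ⟨x, hx, by simp only [Pi.neg_apply] at hx'; linarith⟩) (by
        obtain ⟨x, hx, hx'⟩ := hη1
        exact ⟨x, hx, by simp only [Pi.neg_apply] at hx'; linarith⟩)
      convert this using 4
      simp only [Pi.neg_apply]
      exact le_neg) ⟨p, hpV, le_rfl⟩
  refine false_of_crossing hK hKc (p := p) (fun hpK => by have := hpK.2; linarith) hε0 hε0 h12 h23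
    h34 h41 ⟨hεm.1.2, by linarith⟩ ⟨hεm.2, by linarith⟩ hNc ?_ ?_ ?_ ?_ ?_
  · rw [Set.disjoint_left]
    rintro x ⟨_, hx⟩ ⟨_, hx'⟩
    simp only [Pi.neg_apply] at hx
    linarith
  · rintro r ⟨hr0, hr1⟩ ⟨_, hx⟩
    simp only [Pi.neg_apply] at hx
    rcases hr0.eq_or_lt with rfl | hr
    · simp at hx
    · have := (hall ⟨hr, hr1⟩).1.1.1
      linarith
  · rintro r ⟨hr0, hr1⟩ ⟨_, hx⟩
    simp only [Pi.neg_apply] at hx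
    rcases hr0.eq_or_lt with rfl | hr
    · simp at hx
    · have := (hall ⟨hr, hr1⟩).1.1.2.2.1
      linarith
  · filter_upwards [hev, hray α₂] with t ht ht'
    exact ⟨ht', neg_lt_neg ht.2.1⟩
  · filter_upwards [hev, hray α₄] with t ht ht'
    exact ⟨ht', neg_lt_neg ht.2.2.2⟩

/-- The outside of a disc in the complex plane is preconnected. -/
theorem Complex.isPreconnected_setOf_le_norm (R : ℝ) : IsPreconnected {z : ℂ | R ≤ ‖z‖} := by
  rcases le_or_gt R 0 with hR | hR
  · rw [show {z : ℂ | R ≤ ‖z‖} = univ from eq_univ_of_forall fun z => hR.trans (norm_nonneg z)]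
    exact isPreconnected_univ
  · have h : {z : ℂ | R ≤ ‖z‖} = Complex.exp '' {w | Real.log R ≤ w.re} := by
      ext z
      constructor
      · intro (hz : R ≤ ‖z‖)
        have hz0 : z ≠ 0 := norm_pos_iff.1 (hR.trans_le hz)
        exact ⟨Complex.log z, by
          rw [mem_ofPred_eq, Complex.log_re]
          exact Real.log_le_log hR hz, Complex.exp_log hz0⟩
      · rintro ⟨w, hw, rfl⟩
        rw [mem_ofPred_eq, Complex.norm_exp, ← Real.log_le_iff_le_exp hR]
        exact hw
    rw [h]
    exact (convex_halfSpace_re_ge (Real.log R)).isPreconnected.image _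
      Complex.continuous_exp.continuousOn

theorem mem_connectedComponentIn_of_mem_closure {X : Type*} [TopologicalSpace X] {O : Set X}
    {a x : X} (ha : a ∈ O) (hx : x ∈ O) (hxc : x ∈ closure (connectedComponentIn O a)) :
    x ∈ connectedComponentIn O a := by
  have h : IsPreconnected (insert x (connectedComponentIn O a)) :=
    isPreconnected_connectedComponentIn.subset_closure (subset_insert _ _)
      (insert_subset hxc subset_closure)
  exact h.subset_connectedComponentIn (mem_insert_of_mem _ (mem_connectedComponentIn ha))
    (insert_subset hx (connectedComponentIn_subset O a)) (mem_insert _ _)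

/-- A harmonic map from a compact set `V` to the plane such that every level half-plane meets the
image of the boundary in a connected set, and such that no bounded domain meeting the interior has
its boundary inside a proper subset of `frontier V`. -/
structure IsHarmonicLevelMap (V : Set ℂ) (F : ℂ → ℝ × ℝ) : Prop where
  isCompact : IsCompact V
  continuousOn : ContinuousOn F V
  harmonicAt : ∀ p ∈ interior V, ∀ l : ℝ × ℝ →L[ℝ] ℝ,
    InnerProductSpace.HarmonicAt (fun z => l (F z)) p
  frontier_subset : ∀ D : Set ℂ, IsOpen D → Bornology.IsBounded D → ∀ p ∈ D, p ∈ interior V →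
    frontier D ⊆ frontier V → frontier V ⊆ frontier D
  isPreconnected_level : ∀ l : ℝ × ℝ →L[ℝ] ℝ, ∀ δ : ℝ, (∃ x ∈ V, δ < l (F x)) →
    (∃ x ∈ V, l (F x) < δ) → IsPreconnected {x | x ∈ frontier V ∧ δ ≤ l (F x)}
  exists_ne : ∀ l : ℝ × ℝ →L[ℝ] ℝ, l ≠ 0 → ∀ c : ℝ, ∃ x ∈ frontier V, l (F x) ≠ c

namespace IsHarmonicLevelMap

variable {V : Set ℂ} {F : ℂ → ℝ × ℝ}

theorem isPreconnected_level' (H : IsHarmonicLevelMap V F) (l : ℝ × ℝ →L[ℝ] ℝ) (δ : ℝ)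
    (h1 : ∃ x ∈ V, δ < l (F x)) (h2 : ∃ x ∈ V, l (F x) < δ) :
    IsPreconnected {x | x ∈ frontier V ∧ l (F x) ≤ δ} := by
  have := H.isPreconnected_level (-l) (-δ) (by simpa using h2) (by simpa using h1)
  simpa using this

theorem continuousOn_comp (H : IsHarmonicLevelMap V F) (l : ℝ × ℝ →L[ℝ] ℝ) :
    ContinuousOn (fun z => l (F z)) V :=
  l.continuous.comp_continuousOn H.continuousOn

/-- The differential of a harmonic level map is invertible at every interior point. -/
theorem exists_hasStrictFDerivAt (H : IsHarmonicLevelMap V F) {p : ℂ} (hp : p ∈ interior V) :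
    ∃ A : ℂ ≃L[ℝ] ℝ × ℝ, HasStrictFDerivAt F (A : ℂ →L[ℝ] ℝ × ℝ) p := by
  have hF : ContDiffAt ℝ 2 F p :=
    (H.harmonicAt p hp (ContinuousLinearMap.fst ℝ ℝ ℝ)).1.prodMk
      (H.harmonicAt p hp (ContinuousLinearMap.snd ℝ ℝ ℝ)).1
  have hst : HasStrictFDerivAt F (fderiv ℝ F p) p := hF.hasStrictFDerivAt (by norm_num)
  have hsurj : (fderiv ℝ F p : ℂ →ₗ[ℝ] ℝ × ℝ).range = ⊤ := by
    by_contra hne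
    obtain ⟨f, hf0, hf⟩ := Submodule.exists_le_ker_of_lt_top _ (lt_top_iff_ne_top.2 hne)
    set l : ℝ × ℝ →L[ℝ] ℝ := f.toContinuousLinearMap with hl
    have hl0 : l ≠ 0 := fun h0 => hf0 (by
      ext <;> simpa [hl] using congrArg (fun g : ℝ × ℝ →L[ℝ] ℝ => g _) h0)
    refine fderiv_ne_zero_of_isPreconnected_levels H.isCompact (H.continuousOn_comp l)
      (fun p hp => H.harmonicAt p hp l) (H.exists_ne l hl0) H.frontier_subset
      (H.isPreconnected_level l) (H.isPreconnected_level' l) hp ?_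
    have h1 : HasFDerivAt (fun z => l (F z)) (l.comp (fderiv ℝ F p)) p :=
      l.hasFDerivAt.comp p hst.hasFDerivAt
    rw [h1.fderiv]
    refine ContinuousLinearMap.ext fun v => ?_
    exact LinearMap.mem_ker.1 (hf ⟨v, rfl⟩)
  have hinj : Function.Injective (fderiv ℝ F p : ℂ →ₗ[ℝ] ℝ × ℝ) :=
    (LinearMap.injective_iff_surjective_of_finrank_eq_finrank (by
      simp [Complex.finrank_real_complex])).2 (LinearMap.range_eq_top.1 hsurj)
  refine ⟨(LinearEquiv.ofBijective (fderiv ℝ F p : ℂ →ₗ[ℝ] ℝ × ℝ)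
    ⟨hinj, LinearMap.range_eq_top.1 hsurj⟩).toContinuousLinearEquiv, ?_⟩
  convert hst using 1
  ext v <;> rfl

theorem map_nhds_eq (H : IsHarmonicLevelMap V F) {p : ℂ} (hp : p ∈ interior V) :
    map F (𝓝 p) = 𝓝 (F p) := by
  obtain ⟨A, hA⟩ := H.exists_hasStrictFDerivAt hp
  exact hA.map_nhds_eq_of_equiv

/-- The boundary of `V` is reached from infinity without entering `V`. -/
theorem frontier_subset_closure_component (H : IsHarmonicLevelMap V F) {p : ℂ}
    (hp : p ∈ interior V) {a : ℂ} (hV : ∀ z ∈ V, ‖z‖ < ‖a‖) :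
    frontier V ⊆ closure (connectedComponentIn Vᶜ a) := by
  have haV : a ∈ Vᶜ := fun h => lt_irrefl _ (hV a h)
  set U := connectedComponentIn Vᶜ a with hU
  have hUo : IsOpen U := H.isCompact.isClosed.isOpen_compl.connectedComponentIn
  have hcl : closure U ⊆ (interior V)ᶜ := by
    rw [← closure_compl]
    exact closure_mono (connectedComponentIn_subset _ _)
  have hout : {z : ℂ | ‖a‖ ≤ ‖z‖} ⊆ U :=
    (Complex.isPreconnected_setOf_le_norm ‖a‖).subset_connectedComponentIn (le_refl ‖a‖)
      (fun z hz hzV => not_lt.2 hz (hV z hzV))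
  have hb : Bornology.IsBounded (closure U)ᶜ := by
    refine (Metric.isBounded_closedBall (x := (0 : ℂ)) (r := ‖a‖)).subset fun z hz => ?_
    rw [mem_closedBall_zero_iff]
    by_contra! hlt
    exact hz (subset_closure (hout hlt.le))
  have hfr : frontier (closure U)ᶜ ⊆ frontier V := by
    rw [frontier_compl]
    intro x hx
    have hx' := frontier_closure_subset hx
    refine ⟨?_, hcl hx'.1⟩
    by_contra hxV
    rw [H.isCompact.isClosed.closure_eq] at hxV
    exact hx'.2 (hUo.interior_eq.symm ▸ mem_connectedComponentIn_of_mem_closure haV hxV hx'.1)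
  have := H.frontier_subset (closure U)ᶜ isClosed_closure.isOpen_compl hb p
    (fun h => hcl h hp) hp hfr
  rw [frontier_compl] at this
  exact this.trans (frontier_subset_closure.trans (by rw [closure_closure]))

/-- Let the compact set `K ⊆ V` meet a vertical level line of `F` only in the fibre over `c`.
Then the other points of `V` on this level line are not separated from infinity by `K`. -/
theorem mem_component_of_fst_eq (H : IsHarmonicLevelMap V F) {K : Set ℂ} (hK : IsCompact K)
    (hKV : K ⊆ V) {c : ℝ × ℝ} (hKc : ∀ x ∈ K, (F x).1 = c.1 → F x = c) {a p z : ℂ}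
    (hp : p ∈ interior V) (hV : ∀ z ∈ V, ‖z‖ < ‖a‖) (hz : z ∈ V) (hz1 : (F z).1 = c.1)
    (hz2 : (F z).2 ≠ c.2) : z ∈ connectedComponentIn Kᶜ a := by
  have haV : a ∈ Vᶜ := fun h => lt_irrefl _ (hV a h)
  have haK : a ∈ Kᶜ := fun h => haV (hKV h)
  set U := connectedComponentIn Kᶜ a with hU
  have hUo : IsOpen U := hK.isClosed.isOpen_compl.connectedComponentIn
  have hout : {z : ℂ | ‖a‖ ≤ ‖z‖} ⊆ U :=
    (Complex.isPreconnected_setOf_le_norm ‖a‖).subset_connectedComponentIn (le_refl ‖a‖)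
      (fun z hz hzK => not_lt.2 hz (hV z (hKV hzK)))
  have hVU : connectedComponentIn Vᶜ a ⊆ U := connectedComponentIn_mono _ (compl_subset_compl.2 hKV)
  by_contra hzU
  have hzK : z ∉ K := fun h => hz2 (by rw [hKc z h hz1])
  set D := Kᶜ ∩ Uᶜ with hD
  have hDcl : closure D ⊆ Uᶜ := closure_minimal inter_subset_right hUo.isClosed_compl
  have hDo : IsOpen D := by
    have : D = Kᶜ ∩ (closure U)ᶜ := by
      ext x
      refine ⟨fun hx => ⟨hx.1, fun h => hx.2 ?_⟩, fun hx => ⟨hx.1, fun h => hx.2 (subset_closure h)⟩⟩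
      exact mem_connectedComponentIn_of_mem_closure haK hx.1 h
    rw [this]
    exact hK.isClosed.isOpen_compl.inter isClosed_closure.isOpen_compl
  set σ := (F z).2 - c.2 with hσ
  have hσ0 : σ ≠ 0 := sub_ne_zero.2 hz2
  have hT : IsCompact (V ∩ closure D ∩ {x | x ∈ V ∧ (F x).1 = c.1}) := by
    refine (H.isCompact.inter_right isClosed_closure).inter_right ?_
    exact (continuous_fst.comp_continuousOn H.continuousOn).preimage_isClosed_of_isClosed
      H.isCompact.isClosed (isClosed_singleton (x := c.1))
  obtain ⟨m, ⟨⟨hmV, hmD⟩, _, hm1⟩, hmax⟩ := hT.exists_isMaxOn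
    (f := fun x => σ * ((F x).2 - c.2)) ⟨z, ⟨hz, subset_closure ⟨hzK, hzU⟩⟩, hz, hz1⟩
    (continuousOn_const.mul (((continuous_snd.comp_continuousOn H.continuousOn).mono
      (fun x hx => hx.1.1)).sub continuousOn_const))
  have hmpos : 0 < σ * ((F m).2 - c.2) :=
    lt_of_lt_of_le (mul_self_pos.2 hσ0) (hmax ⟨⟨hz, subset_closure ⟨hzK, hzU⟩⟩, hz, hz1⟩)
  have hmK : m ∉ K := fun h => by
    rw [hKc m h hm1] at hmpos
    simp at hmpos
  have hmDo : m ∈ D := ⟨hmK, hDcl hmD⟩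
  by_cases hmi : m ∈ interior V
  · have hn : ∀ᶠ x in 𝓝 m, x ∈ D ∧ x ∈ V :=
      (show ∀ᶠ x in 𝓝 m, x ∈ D from hDo.mem_nhds hmDo).and (mem_interior_iff_mem_nhds.1 hmi)
    have hn' : ∀ᶠ y in 𝓝 (F m), ∃ x, (x ∈ D ∧ x ∈ V) ∧ F x = y := by
      rw [← H.map_nhds_eq hmi, eventually_map]
      filter_upwards [hn] with x hx using ⟨x, hx, rfl⟩
    have hlim : Tendsto (fun t : ℝ => F m + (0, t * σ)) (𝓝[>] 0) (𝓝 (F m)) := by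
      have : Continuous (fun t : ℝ => F m + (0, t * σ)) := by fun_prop
      have h0 := (this.tendsto 0).mono_left (nhdsWithin_le_nhds (s := Ioi 0))
      have e : F m + ((0 : ℝ), (0 : ℝ) * σ) = F m := by ext <;> simp
      rwa [e] at h0
    obtain ⟨t, ⟨x, ⟨hxD, hxV⟩, hx⟩, ht⟩ := ((hlim.eventually hn').and self_mem_nhdsWithin).exists
    have hx1 : (F x).1 = c.1 := by rw [hx]; simpa using hm1
    have hx2 : (F x).2 = (F m).2 + t * σ := by rw [hx]; simp
    have hle := hmax ⟨⟨hxV, subset_closure hxD⟩, hxV, hx1⟩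
    simp only [mem_ofPred_eq, hx2] at hle
    have : 0 < t * (σ * σ) := mul_pos ht (mul_self_pos.2 hσ0)
    nlinarith
  · have hmf : m ∈ frontier V := ⟨subset_closure hmV, hmi⟩
    obtain ⟨x, hxD, hxU⟩ := mem_closure_iff.1
      (H.frontier_subset_closure_component hp hV hmf) D hDo hmDo
    exact hxD.2 (hVU hxU)

end IsHarmonicLevelMap

theorem HasDerivAt.eventually_lt_of_pos {f : ℝ → ℝ} {d x : ℝ} (hf : HasDerivAt f d x)
    (hd : 0 < d) : ∀ᶠ t in 𝓝[>] 0, f x < f (x + t) := by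
  have h := (hasDerivAt_iff_tendsto_slope_zero.1 hf).mono_left
    (nhdsWithin_mono 0 (s := Ioi 0) (fun x (hx : 0 < x) => hx.ne'))
  filter_upwards [h.eventually (lt_mem_nhds hd), self_mem_nhdsWithin] with t ht (ht0 : 0 < t)
  rw [smul_eq_mul] at ht
  exact sub_pos.1 ((mul_pos_iff_of_pos_left (inv_pos.2 ht0)).1 ht)

theorem Complex.hasDerivAt_add_ofReal_mul (x v : ℂ) (t : ℝ) :
    HasDerivAt (fun r : ℝ => x + r * v) v t := by
  simpa using ((Complex.ofRealCLM.hasDerivAt (x := t)).mul_const v).const_add x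

theorem HasFDerivAt.eventually_lt_add_mul {f : ℂ → ℝ} {f' : ℂ →L[ℝ] ℝ} {x v : ℂ}
    (hf : HasFDerivAt f f' x) (hv : 0 < f' v) : ∀ᶠ r : ℝ in 𝓝[>] 0, f x < f (x + r * v) := by
  have h : HasDerivAt (fun r : ℝ => f (x + r * v)) (f' v) 0 :=
    HasFDerivAt.comp_hasDerivAt (l := f) (0 : ℝ) (by simpa using hf)
      (Complex.hasDerivAt_add_ofReal_mul x v 0)
  simpa using h.eventually_lt_of_pos hv

namespace IsHarmonicLevelMap

variable {V : Set ℂ} {F : ℂ → ℝ × ℝ}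

/-- A short transversal to the vertical level line of `F` through `x`. -/
theorem exists_transversal {x v : ℂ} (hx : x ∈ interior V) {A : ℂ →L[ℝ] ℝ × ℝ}
    (hA : HasFDerivAt F A x) (hv : 0 < (A v).1) : ∃ ε : ℝ, 0 < ε ∧ ∀ r ∈ Ioc 0 ε,
      (x + r * v ∈ V ∧ (F x).1 < (F (x + r * v)).1) ∧
      (x - r * v ∈ V ∧ (F (x - r * v)).1 < (F x).1) := by
  have hV : ∀ w : ℂ, ∀ᶠ r : ℝ in 𝓝[>] 0, x + r * w ∈ V := fun w => by
    have hc : Continuous (fun r : ℝ => x + r * w) := by fun_prop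
    have : Tendsto (fun r : ℝ => x + r * w) (𝓝[>] 0) (𝓝 x) := by
      simpa using (hc.tendsto 0).mono_left nhdsWithin_le_nhds
    exact this.eventually (mem_interior_iff_mem_nhds.1 hx)
  have h1 : HasFDerivAt (fun z => (F z).1) ((ContinuousLinearMap.fst ℝ ℝ ℝ).comp A) x := hA.fst
  have h2 := h1.eventually_lt_add_mul (v := v) hv
  have h3 := h1.neg.eventually_lt_add_mul (v := -v) (by simpa using hv)
  obtain ⟨ε, hε, hall⟩ := (mem_nhdsGT_iff_exists_Ioc_subset).1
    (((hV v).and h2).and ((hV (-v)).and h3))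
  refine ⟨ε, hε, fun r hr => ?_⟩
  have := hall hr
  simpa [mul_neg, ← sub_eq_add_neg] using this

theorem mem_and_eq_of_mem_transversal {x v : ℂ} (hx : x ∈ V) {ε : ℝ} (h : ∀ r ∈ Ioc 0 ε,
      (x + r * v ∈ V ∧ (F x).1 < (F (x + r * v)).1) ∧
      (x - r * v ∈ V ∧ (F (x - r * v)).1 < (F x).1)) {z : ℂ}
    (hz : z ∈ (fun r : ℝ => x + r * v) '' Icc (-ε) ε) : z ∈ V ∧ ((F z).1 = (F x).1 → z = x) := by
  obtain ⟨r, ⟨hr1, hr2⟩, rfl⟩ := hz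
  rcases lt_trichotomy r 0 with hr | rfl | hr
  · have := (h (-r) ⟨by linarith, by linarith⟩).2
    simp only [Complex.ofReal_neg, neg_mul, sub_neg_eq_add] at this
    exact ⟨this.1, fun he => absurd he this.2.ne⟩
  · simpa using hx
  · have := (h r ⟨hr, hr2⟩).1
    exact ⟨this.1, fun he => absurd he this.2.ne'⟩

/-- The vertical level line of `F` through `p` enters each of the two half-discs at `p` bounded
by the tangent of the horizontal level line. -/
theorem exists_mem_level {p : ℂ} (hp : p ∈ interior V) {A : ℂ ≃L[ℝ] ℝ × ℝ}
    (hA : HasStrictFDerivAt F (A : ℂ →L[ℝ] ℝ × ℝ) p) {ρ σ : ℝ} (hρ : 0 < ρ) (hσ : σ ≠ 0) :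
    ∃ z ∈ V, (F z).1 = (F p).1 ∧ (F z).2 ≠ (F p).2 ∧ z ∈ Metric.ball p ρ ∧
      σ * (A p).2 < σ * (A z).2 := by
  have hline : HasDerivAt (fun t : ℝ => F p + t • ((0, σ) : ℝ × ℝ)) (0, σ) 0 := by
    simpa using ((hasDerivAt_id (0 : ℝ)).smul_const ((0, σ) : ℝ × ℝ)).const_add (F p)
  have hg := hA.to_localInverse.hasFDerivAt
  have hgd : HasDerivAt (fun t : ℝ => hA.localInverse F A p (F p + t • ((0, σ) : ℝ × ℝ)))
      (A.symm (0, σ)) 0 :=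
    HasFDerivAt.comp_hasDerivAt (l := hA.localInverse F A p)
      (l' := (A.symm : ℝ × ℝ →L[ℝ] ℂ)) (0 : ℝ) (by simpa using hg) hline
  have hd : HasDerivAt (fun t : ℝ =>
      σ * (A (hA.localInverse F A p (F p + t • ((0, σ) : ℝ × ℝ)))).2) (σ * σ) 0 := by
    have := (((ContinuousLinearMap.snd ℝ ℝ ℝ).comp
      (A : ℂ →L[ℝ] ℝ × ℝ)).hasFDerivAt.comp_hasDerivAt (0 : ℝ) hgd).const_mul σ
    simpa using this
  have h1 := hd.eventually_lt_of_pos (mul_self_pos.2 hσ)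
  have hlim : Tendsto (fun t : ℝ => F p + t • ((0, σ) : ℝ × ℝ)) (𝓝[>] 0) (𝓝 (F p)) := by
    simpa using hline.continuousAt.tendsto.mono_left (nhdsWithin_le_nhds (s := Ioi 0))
  have h2 := hlim.eventually hA.eventually_right_inverse
  have h3 := (hA.localInverse_tendsto.comp hlim).eventually
    ((show ∀ᶠ z in 𝓝 p, z ∈ V from mem_interior_iff_mem_nhds.1 hp).and
      (Metric.ball_mem_nhds p hρ))
  obtain ⟨t, ⟨⟨ht1, ht2⟩, ht3⟩, ht0⟩ := (((h1.and h2).and h3).and self_mem_nhdsWithin).exists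
  have ht0' : t ≠ 0 := ne_of_gt ht0
  simp only [zero_smul, add_zero, zero_add, hA.localInverse_apply_image] at ht1
  exact ⟨hA.localInverse F A p (F p + t • ((0, σ) : ℝ × ℝ)), ht3.1, by rw [ht2]; simp,
    by rw [ht2]; simp [ht0', hσ], ht3.2, ht1⟩

theorem injOn_interior (H : IsHarmonicLevelMap V F) : InjOn F (interior V) := by
  intro p hp q hq hpq
  by_contra hne
  have hpV := interior_subset hp
  have hqV := interior_subset hq
  obtain ⟨A, hA⟩ := H.exists_hasStrictFDerivAt hp
  obtain ⟨B, hB⟩ := H.exists_hasStrictFDerivAt hq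
  set w := A.symm (1, 0) with hw
  have hAw : A w = (1, 0) := A.apply_symm_apply _
  have hw0 : w ≠ 0 := fun h0 => by
    rw [h0, map_zero] at hAw
    exact zero_ne_one (congrArg Prod.fst hAw)
  set α := w.arg with hα
  set u := Complex.exp (α * Complex.I) with hu
  have hwu : w = ‖w‖ • u := by
    rw [Complex.real_smul]
    exact (Complex.norm_mul_exp_arg_mul_I w).symm
  have hAu : ‖w‖ • A u = (1, 0) := by rw [← map_smul, ← hwu, hAw]
  have hwn : 0 < ‖w‖ := norm_pos_iff.2 hw0
  have hAu1 : 0 < (A u).1 := by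
    have : ‖w‖ * (A u).1 = 1 := congrArg Prod.fst hAu
    exact pos_of_mul_pos_right (this ▸ one_pos) hwn.le
  have hAu2 : (A u).2 = 0 := by
    have : ‖w‖ * (A u).2 = 0 := congrArg Prod.snd hAu
    exact (mul_eq_zero.1 this).resolve_left hwn.ne'
  set v := B.symm (1, 0) with hv
  obtain ⟨ε, hε, hεp⟩ := exists_transversal hp hA.hasFDerivAt (v := u) hAu1
  obtain ⟨η, hη, hηq⟩ := exists_transversal hq hB.hasFDerivAt (v := v) (by
    show 0 < (B v).1
    rw [hv, B.apply_symm_apply]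
    exact one_pos)
  have hp1 := hεp ε (right_mem_Ioc.2 hε)
  have hq1 := hηq η (right_mem_Ioc.2 hη)
  have hFq : (F q).1 = (F p).1 := by rw [hpq]
  obtain ⟨δ, hδ0, hδ⟩ := exists_between (lt_min
    (lt_min (sub_pos.2 hp1.1.2) (sub_pos.2 hp1.2.2))
    (lt_min (sub_pos.2 hq1.1.2) (sub_pos.2 hq1.2.2)))
  simp only [lt_min_iff, hFq] at hδ
  obtain ⟨⟨hδ1, hδ2⟩, hδ3, hδ4⟩ := hδ
  set Kp := {x | x ∈ V ∧ (F p).1 + δ ≤ (F x).1} with hKp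
  set Km := {x | x ∈ V ∧ (F x).1 ≤ (F p).1 - δ} with hKm
  set Sq := (fun r : ℝ => q + r * v) '' Icc (-η) η with hSq
  set Sp := (fun r : ℝ => p + r * u) '' Icc (-ε) ε with hSp
  have hc1 : ContinuousOn (fun z => (F z).1) V := continuous_fst.comp_continuousOn H.continuousOn
  have hKpc : IsCompact Kp := H.isCompact.of_isClosed_subset
    (hc1.preimage_isClosed_of_isClosed H.isCompact.isClosed isClosed_Ici) (fun x hx => hx.1)
  have hKmc : IsCompact Km := H.isCompact.of_isClosed_subset
    (hc1.preimage_isClosed_of_isClosed H.isCompact.isClosed isClosed_Iic) (fun x hx => hx.1)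
  have hSqc : IsCompact Sq := isCompact_Icc.image (by fun_prop)
  have hSpc : IsCompact Sp := isCompact_Icc.image (by fun_prop)
  have hKpp : IsPreconnected Kp :=
    isPreconnected_superlevel H.isCompact hc1
      (fun x hx => H.harmonicAt x hx (ContinuousLinearMap.fst ℝ ℝ ℝ))
      (H.isPreconnected_level (ContinuousLinearMap.fst ℝ ℝ ℝ) ((F p).1 + δ)
        ⟨_, hp1.1.1, by show _ < (F _).1; linarith⟩ ⟨p, hpV, by show (F _).1 < _; linarith⟩)
  have hKmp : IsPreconnected Km := by
    have := isPreconnected_superlevel H.isCompact (h := fun z => (-(F z).1)) hc1.neg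
      (fun x hx => H.harmonicAt x hx (-ContinuousLinearMap.fst ℝ ℝ ℝ)) (δ := δ - (F p).1)
      (H.isPreconnected_level (-ContinuousLinearMap.fst ℝ ℝ ℝ) (δ - (F p).1)
        ⟨_, hp1.2.1, by show _ < -(F _).1; linarith⟩ ⟨p, hpV, by show -(F _).1 < _; linarith⟩)
    convert this using 4
    constructor <;> intro h <;> linarith
  have hSqp : IsPreconnected Sq := isPreconnected_Icc.image _ (by fun_prop)
  set K₀ := Kp ∪ Sq ∪ Km with hK₀
  have hK₀c : IsCompact K₀ := (hKpc.union hSqc).union hKmc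
  have hK₀p : IsPreconnected K₀ := by
    refine IsPreconnected.union (q - η * v) (Or.inr ⟨-η, ⟨le_rfl, by linarith⟩, ?_⟩)
      ⟨hq1.2.1, by linarith⟩ (IsPreconnected.union (q + η * v) ⟨hq1.1.1, by linarith⟩
        ⟨η, ⟨by linarith, le_rfl⟩, rfl⟩ hKpp hSqp) hKmp
    push_cast
    ring
  have hSqV : ∀ z ∈ Sq, z ∈ V ∧ ((F z).1 = (F q).1 → z = q) := fun z hz =>
    mem_and_eq_of_mem_transversal hqV hηq hz
  have hSpV : ∀ z ∈ Sp, z ∈ V ∧ ((F z).1 = (F p).1 → z = p) := fun z hz =>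
    mem_and_eq_of_mem_transversal hpV hεp hz
  have hpK₀ : p ∉ K₀ := by
    rintro ((h | h) | h)
    · have := h.2
      linarith
    · exact hne ((hSqV p h).2 hFq.symm)
    · have := h.2
      linarith
  set K := K₀ ∪ Sp with hK
  have hKV : K ⊆ V := by
    rintro z (((h | h) | h) | h)
    exacts [h.1, (hSqV z h).1, h.1, (hSpV z h).1]
  have hKF : ∀ z ∈ K, (F z).1 = (F p).1 → F z = F p := by
    rintro z (((h | h) | h) | h) hz
    · have := h.2
      linarith
    · rw [(hSqV z h).2 (hz.trans hFq.symm), hpq]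
    · have := h.2
      linarith
    · rw [(hSpV z h).2 hz]
  obtain ⟨R, hR⟩ := H.isCompact.isBounded.exists_norm_le
  have ha : ∀ z ∈ V, ‖z‖ < ‖((|R| + 1 : ℝ) : ℂ)‖ := fun z hz => by
    rw [Complex.norm_real, Real.norm_of_nonneg (by positivity)]
    linarith [hR z hz, le_abs_self R]
  set a : ℂ := ((|R| + 1 : ℝ) : ℂ) with haR
  obtain ⟨ρ, hρ, hball⟩ := Metric.isOpen_iff.1 hK₀c.isClosed.isOpen_compl p hpK₀
  have hhalf : ∀ x : ℂ, (A x).2 ≠ 0 →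
      ∀ᶠ t : ℝ in 𝓝[>] 0, p + t * x ∈ connectedComponentIn Kᶜ a := by
    intro x hx
    set σ := (A x).2 with hσ
    obtain ⟨z, hzV, hz1, hz2, hzb, hzA⟩ := exists_mem_level hp hA hρ hx
    have hzU := H.mem_component_of_fst_eq (hK₀c.union hSpc) hKV hKF hp ha hzV hz1 hz2
    have hconv : Convex ℝ (Metric.ball p ρ ∩ {y | σ * (A p).2 < σ * (A y).2}) :=
      (convex_ball p ρ).inter (convex_halfSpace_gt (f := fun y => σ * (A y).2)
        ⟨fun y y' => by simp [mul_add], fun c y => by rw [map_smul]; simp [mul_left_comm]⟩ _)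
    have hsub : Metric.ball p ρ ∩ {y | σ * (A p).2 < σ * (A y).2} ⊆ Kᶜ := by
      rintro y ⟨hyb, hyA⟩ (hy | ⟨r, -, rfl⟩)
      · exact hball hyb hy
      · have : A (p + r * u) = A p + r • A u := by
          rw [map_add, ← Complex.real_smul, map_smul]
        simp [this, hAu2] at hyA
    have hsubU := hconv.isPreconnected.subset_connectedComponentIn ⟨hzb, hzA⟩ hsub
    rw [← connectedComponentIn_eq hzU] at hsubU
    have hb : ∀ᶠ t : ℝ in 𝓝[>] 0, p + t * x ∈ Metric.ball p ρ := by
      have hc : Continuous (fun r : ℝ => p + r * x) := by fun_prop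
      have : Tendsto (fun r : ℝ => p + r * x) (𝓝[>] 0) (𝓝 p) := by
        simpa using (hc.tendsto 0).mono_left nhdsWithin_le_nhds
      exact this.eventually (Metric.ball_mem_nhds p hρ)
    filter_upwards [hb, self_mem_nhdsWithin] with t ht (ht0 : 0 < t)
    refine hsubU ⟨ht, ?_⟩
    have : A (p + t * x) = A p + t • A x := by
      rw [map_add, ← Complex.real_smul, map_smul]
    have h0 : 0 < t * (σ * σ) := mul_pos ht0 (mul_self_pos.2 hx)
    simp only [mem_ofPred_eq, this, Prod.snd_add, Prod.smul_snd, smul_eq_mul, ← hσ]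
    linarith
  have hAI : (A (Complex.I * u)).2 ≠ 0 := fun h0 => by
    have h1 : A (Complex.I * u) = ((A (Complex.I * u)).1 * ‖w‖) • A u := by
      rw [mul_smul, hAu]
      ext <;> simp [h0]
    rw [← map_smul] at h1
    have h2 := A.injective h1
    rw [Complex.real_smul] at h2
    have h3 := congrArg Complex.im (mul_right_cancel₀ (Complex.exp_ne_zero _) h2)
    simp at h3
  have e3 : Complex.exp ((α + Real.pi : ℝ) * Complex.I) = -u := by
    push_cast
    rw [add_mul, Complex.exp_add, Complex.exp_pi_mul_I, mul_neg_one]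
  have e2 : Complex.exp ((α + Real.pi / 2 : ℝ) * Complex.I) = Complex.I * u := by
    push_cast
    rw [add_mul, Complex.exp_add, Complex.exp_pi_div_two_mul_I, mul_comm]
  have e4 : Complex.exp ((α + Real.pi + Real.pi / 2 : ℝ) * Complex.I) = -(Complex.I * u) := by
    rw [Complex.ofReal_add, add_mul, Complex.exp_add, e3, Complex.ofReal_div, Complex.ofReal_ofNat,
      Complex.exp_pi_div_two_mul_I]
    ring
  have hpi := Real.pi_pos
  have hKU : ∀ z ∈ K, z ∉ connectedComponentIn Kᶜ a := fun z hz h =>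
    connectedComponentIn_subset _ _ h hz
  refine false_of_crossing hK₀c hK₀p hpK₀ hε hε (α₁ := α) (α₂ := α + Real.pi / 2)
    (α₃ := α + Real.pi) (α₄ := α + Real.pi + Real.pi / 2) (by linarith) (by linarith)
    (by linarith) (by linarith) (Or.inl (Or.inl ⟨hp1.1.1, by linarith⟩)) (Or.inr ?_)
    (isPreconnected_connectedComponentIn (F := Kᶜ) (x := a))
    (Set.disjoint_left.2 fun z hz hz' => hKU z (Or.inl hz') hz) ?_ ?_ ?_ ?_
  · rw [e3, mul_neg, ← sub_eq_add_neg]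
    exact ⟨hp1.2.1, by linarith⟩
  · exact fun r hr => hKU _ (Or.inr ⟨r, ⟨by linarith [hr.1], hr.2⟩, rfl⟩)
  · intro r hr
    rw [e3]
    exact hKU _ (Or.inr ⟨-r, ⟨by linarith [hr.2], by linarith [hr.1]⟩, by push_cast; ring⟩)
  · rw [e2]
    exact hhalf _ hAI
  · rw [e4]
    exact hhalf _ (by rwa [map_neg, Prod.snd_neg, neg_ne_zero])

theorem mem_interior_of_mapsTo (H : IsHarmonicLevelMap V F) {W : Set (ℝ × ℝ)} (hW : MapsTo F V W)
    {p : ℂ} (hp : p ∈ interior V) : F p ∈ interior W := by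
  rw [mem_interior_iff_mem_nhds, ← H.map_nhds_eq hp]
  exact mem_map.2 (mem_of_superset (mem_interior_iff_mem_nhds.1 hp) hW)

theorem injOn (H : IsHarmonicLevelMap V F) {W : Set (ℝ × ℝ)} (hW : MapsTo F V W)
    (hfr : MapsTo F (frontier V) (frontier W)) (hinj : InjOn F (frontier V)) : InjOn F V := by
  have hV : ∀ x ∈ V, x ∈ interior V ∨ x ∈ frontier V := fun x hx => by
    by_cases h : x ∈ interior V
    · exact Or.inl h
    · exact Or.inr ⟨subset_closure hx, h⟩
  intro x hx y hy hxy
  rcases hV x hx with hx' | hx' <;> rcases hV y hy with hy' | hy'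
  · exact H.injOn_interior hx' hy' hxy
  · exact absurd (hxy ▸ H.mem_interior_of_mapsTo hW hx') (hfr hy').2
  · exact absurd (hxy ▸ H.mem_interior_of_mapsTo hW hy') (hfr hx').2
  · exact hinj hx' hy' hxy

end IsHarmonicLevelMap

theorem Function.Periodic.injOn_Ico {X : Type*} {γ : ℝ → X} (hper : Function.Periodic γ 1)
    (hinj : InjOn γ (Ico 0 1)) (t₀ : ℝ) : InjOn γ (Ico t₀ (t₀ + 1)) := by
  intro s hs t ht hst
  have hfr : ∀ t, γ (Int.fract t) = γ t := fun t => by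
    have := hper.sub_int_mul_eq (x := t) ⌊t⌋
    rwa [mul_one] at this
  have h : Int.fract s = Int.fract t := hinj ⟨Int.fract_nonneg s, Int.fract_lt_one s⟩
    ⟨Int.fract_nonneg t, Int.fract_lt_one t⟩ (by rw [hfr, hfr, hst])
  obtain ⟨z, hz⟩ := Int.fract_eq_fract.1 h
  have h1 : ((z : ℤ) : ℝ) < 1 := by linarith [hs.2, ht.1]
  have h2 : ((-1 : ℤ) : ℝ) < z := by push_cast; linarith [hs.1, ht.2]
  have h3 : z < 1 := by exact_mod_cast h1
  have h4 : -1 < z := by exact_mod_cast h2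
  obtain rfl : z = 0 := by omega
  simp only [Int.cast_zero] at hz
  linarith

/-- A proper compact part of a simple closed curve does not separate the plane. -/
theorem subset_frontier_of_periodic {γ : ℝ → ℂ} (hγ : Continuous γ)
    (hper : Function.Periodic γ 1) (hinj : InjOn γ (Ico 0 1)) {p : ℂ} {L : ℝ → ℂ}
    (hL : Continuous L) (hexp : ∀ t, Complex.exp (L t) = γ t - p) {D : Set ℂ}
    (hD : Bornology.IsBounded D) (hp : p ∈ D) (hsub : frontier D ⊆ range γ) :
    range γ ⊆ frontier D := by
  rintro _ ⟨t₀, rfl⟩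
  by_contra ht₀
  have hn : ∀ᶠ t in 𝓝 t₀, γ t ∈ (frontier D)ᶜ :=
    hγ.continuousAt.eventually (isClosed_frontier.isOpen_compl.mem_nhds ht₀)
  obtain ⟨η, hη, hηs⟩ := Metric.eventually_nhds_iff.1 hn
  set S := Icc (t₀ + η) (t₀ + 1 - η) with hS
  have hSI : S ⊆ Ico t₀ (t₀ + 1) := fun t ht => ⟨by linarith [ht.1], by linarith [ht.2]⟩
  have hemb : IsClosedEmbedding (S.domRestrict γ) :=
    (hγ.comp continuous_subtype_val).isClosedEmbedding
      (injOn_iff_injective.1 ((hper.injOn_Ico hinj t₀).mono hSI))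
  obtain ⟨g, hg⟩ := ContinuousMap.exists_extension' hemb
    (⟨fun t : S => L t, hL.comp continuous_subtype_val⟩ : C(S, ℂ))
  refine no_log_on_frontier hD hp g.continuous fun x hx => ?_
  obtain ⟨s, rfl⟩ := hsub hx
  obtain ⟨t, ht, hst⟩ := hper.exists_mem_Ico one_pos s t₀
  rw [hst] at hx ⊢
  have h1 : t₀ + η ≤ t := by
    by_contra! hlt
    exact hηs (by rw [Real.dist_eq, abs_lt]; constructor <;> linarith [ht.1]) hx
  have h2 : t ≤ t₀ + 1 - η := by
    by_contra! hlt
    refine hηs (y := t - 1) (by rw [Real.dist_eq, abs_lt]; constructor <;> linarith [ht.2]) ?_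
    rwa [hper.sub_eq]
  have := congrFun hg ⟨t, h1, h2⟩
  simp only [Function.comp_apply, domRestrict_apply, ContinuousMap.coe_mk] at this
  rw [this, hexp]

theorem isPreconnected_setOf_ne_zero_of_nonneg {E : Type*} [AddCommGroup E] [Module ℝ E]
    [TopologicalSpace E] [ContinuousAdd E] [ContinuousSMul ℝ E] (l : E →L[ℝ] ℝ) :
    IsPreconnected {d : E | d ≠ 0 ∧ 0 ≤ l d} ∨ l = 0 := by
  by_cases hl : l = 0
  · exact Or.inr hl
  left
  obtain ⟨d₀, hd₀⟩ : ∃ d, 0 < l d := by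
    obtain ⟨d, hd⟩ := DFunLike.ne_iff.1 hl
    rcases lt_or_gt_of_ne hd with h | h
    · exact ⟨-d, by simpa using h⟩
    · exact ⟨d, h⟩
  have hstar : StarConvex ℝ d₀ {d : E | d ≠ 0 ∧ 0 ≤ l d} := by
    rintro y ⟨hy0, hy⟩ a b ha hb hab
    rcases ha.eq_or_lt with rfl | ha
    · obtain rfl : b = 1 := by linarith
      simpa using ⟨hy0, hy⟩
    · have hpos : 0 < l (a • d₀ + b • y) := by
        rw [map_add, map_smul, map_smul, smul_eq_mul, smul_eq_mul]
        positivity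
      exact ⟨fun h => by simp [h] at hpos, hpos.le⟩
  exact (hstar.isPathConnected ⟨fun h => by simp [h] at hd₀, hd₀.le⟩).isConnected.isPreconnected

/-- A line through an interior point of a convex body cuts its boundary into connected pieces. -/
theorem Convex.isPreconnected_frontier_halfSpace_of_mem_interior {E : Type*}
    [NormedAddCommGroup E] [NormedSpace ℝ E] {W : Set E} (hW : Convex ℝ W)
    (hb : Bornology.IsBounded W) {o : E} (ho : o ∈ interior W) {l : E →L[ℝ] ℝ} (hl : l ≠ 0) :
    IsPreconnected {y | y ∈ frontier W ∧ l o ≤ l y} := by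
  set S := (fun y => o + y) ⁻¹' W with hS
  have hSc : Convex ℝ S := hW.translate_preimage_right o
  have hS0 : S ∈ 𝓝 (0 : E) := by
    refine (continuous_const_add o).continuousAt.preimage_mem_nhds ?_
    rw [add_zero]
    exact mem_interior_iff_mem_nhds.1 ho
  have hSf : ∀ y, y ∈ frontier S ↔ o + y ∈ frontier W := fun y => by
    rw [show S = (Homeomorph.addLeft o) ⁻¹' W from rfl, ← Homeomorph.preimage_frontier]
    rfl
  have hSb : Bornology.IsVonNBounded ℝ S := by
    rw [NormedSpace.isVonNBounded_iff]
    obtain ⟨R, hR⟩ := hb.exists_norm_le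
    refine isBounded_iff_forall_norm_le.2 ⟨R + ‖o‖, fun y hy => ?_⟩
    calc ‖y‖ = ‖(o + y) - o‖ := by rw [add_sub_cancel_left]
      _ ≤ ‖o + y‖ + ‖o‖ := norm_sub_le _ _
      _ ≤ R + ‖o‖ := by gcongr; exact hR _ hy
  have hpos : ∀ {d : E}, 0 < gauge S d ↔ d ≠ 0 := gauge_pos (absorbent_nhds_zero hS0) hSb
  have hpre := (isPreconnected_setOf_ne_zero_of_nonneg l).resolve_right hl
  have hcont : ContinuousOn (fun d => o + (gauge S d)⁻¹ • d) {d : E | d ≠ 0 ∧ 0 ≤ l d} :=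
    continuousOn_const.add (((continuous_gauge hSc hS0).continuousOn.inv₀
      fun d hd => (hpos.2 hd.1).ne').smul continuousOn_id)
  convert hpre.image _ hcont using 1
  ext y
  constructor
  · rintro ⟨hy, hly⟩
    have hy' : y - o ∈ frontier S := (hSf _).2 (by simpa using hy)
    have h1 := (gauge_eq_one_iff_mem_frontier hSc hS0).2 hy'
    refine ⟨y - o, ⟨hpos.1 (h1 ▸ one_pos), by simpa using hly⟩, by simp [h1]⟩
  · rintro ⟨d, ⟨hd0, hd⟩, rfl⟩
    have hg := hpos.2 hd0
    refine ⟨(hSf _).1 ((gauge_eq_one_iff_mem_frontier hSc hS0).1 ?_), ?_⟩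
    · rw [gauge_smul_of_nonneg (inv_nonneg.2 hg.le), smul_eq_mul, inv_mul_cancel₀ hg.ne']
    · simp only [map_add, map_smul, smul_eq_mul, le_add_iff_nonneg_right]
      positivity

theorem Convex.isPreconnected_frontier_halfSpace {E : Type*}
    [NormedAddCommGroup E] [NormedSpace ℝ E] {W : Set E} (hW : Convex ℝ W)
    (hb : Bornology.IsBounded W) (hne : (interior W).Nonempty) {l : E →L[ℝ] ℝ} {δ : ℝ}
    (h1 : ∃ y ∈ W, δ < l y) (h2 : ∃ y ∈ W, l y < δ) :
    IsPreconnected {y | y ∈ frontier W ∧ δ ≤ l y} := by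
  have hcl : W ⊆ closure (interior W) := by
    rw [hW.closure_interior_eq_closure_of_nonempty_interior hne]
    exact subset_closure
  obtain ⟨y₁, hy₁, hl₁⟩ := h1
  obtain ⟨y₂, hy₂, hl₂⟩ := h2
  obtain ⟨z₁, hz₁, hi₁⟩ := mem_closure_iff.1 (hcl hy₁) {y | δ < l y}
    (isOpen_lt continuous_const l.continuous) hl₁
  obtain ⟨z₂, hz₂, hi₂⟩ := mem_closure_iff.1 (hcl hy₂) {y | l y < δ}
    (isOpen_lt l.continuous continuous_const) hl₂
  obtain ⟨o, ho, rfl⟩ := hW.interior.isPreconnected.intermediate_value hi₂ hi₁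
    l.continuous.continuousOn ⟨le_of_lt hz₂, le_of_lt hz₁⟩
  exact hW.isPreconnected_frontier_halfSpace_of_mem_interior hb ho (fun h => by simp [h] at hz₁)

theorem Function.Periodic.not_injOn_of_continuous {g : ℝ → ℝ} (hg : Continuous g)
    (hper : Function.Periodic g 1) : ¬ InjOn g (Ico 0 1) := by
  intro hinj
  have h := fun a b => isPreconnected_univ.intermediate_value₂ (a := a) (b := b)
    (f := fun t => g (t + 1 / 2)) (g := g) (mem_univ _) (mem_univ _) (by fun_prop) (by fun_prop)
  have h1 : g (1 / 2 + 1 / 2) = g 0 := by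
    rw [show (1 / 2 + 1 / 2 : ℝ) = 0 + 1 by norm_num, hper]
  have hc : ∃ t, g (t + 1 / 2) = g t := by
    rcases le_total (g (1 / 2)) (g 0) with h0 | h0
    · obtain ⟨t, -, ht⟩ := h 0 (1 / 2) (by simpa using h0) (by simpa only [h1] using h0)
      exact ⟨t, ht⟩
    · obtain ⟨t, -, ht⟩ := h (1 / 2) 0 (by simpa only [h1] using h0) (by simpa using h0)
      exact ⟨t, ht⟩
  obtain ⟨t, ht⟩ := hc
  have := hper.injOn_Ico hinj t ⟨by linarith, by linarith⟩ ⟨le_rfl, by linarith⟩ ht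
  linarith

/-- A simple closed curve is not contained in a line. -/
theorem exists_ne_of_periodic {γ : ℝ → ℝ × ℝ} (hγ : Continuous γ)
    (hper : Function.Periodic γ 1) (hinj : InjOn γ (Ico 0 1)) {l : ℝ × ℝ →L[ℝ] ℝ} (hl : l ≠ 0)
    (c : ℝ) : ∃ t, l (γ t) ≠ c := by
  by_contra! hc
  have hlxy : ∀ x : ℝ × ℝ, l x = x.1 * l (1, 0) + x.2 * l (0, 1) := fun x => by
    rw [← smul_eq_mul, ← smul_eq_mul, ← map_smul, ← map_smul, ← map_add]
    congr 1
    ext <;> simp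
  set a := l (1, 0) with ha
  set b := l (0, 1) with hb
  have hab : a * a + b * b ≠ 0 := fun h => hl (by
    have h1 : a = 0 := by nlinarith
    have h2 : b = 0 := by nlinarith
    ext <;> simp [hlxy, h1, h2])
  refine Function.Periodic.not_injOn_of_continuous (g := fun t => a * (γ t).2 - b * (γ t).1)
    (by fun_prop) (fun t => by simp only [hper t]) fun s hs t ht hst => hinj hs ht ?_
  have h1 := (hc s).trans (hc t).symm
  rw [hlxy, hlxy] at h1
  have hst' : a * (γ s).2 - b * (γ s).1 = a * (γ t).2 - b * (γ t).1 := hst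
  ext
  · refine sub_eq_zero.1 ((mul_eq_zero.1 (?_ : (a * a + b * b) * _ = 0)).resolve_left hab)
    linear_combination a * h1 - b * hst'
  · refine sub_eq_zero.1 ((mul_eq_zero.1 (?_ : (a * a + b * b) * _ = 0)).resolve_left hab)
    linear_combination b * h1 + a * hst'

theorem Convex.interior_nonempty_of_forall_exists_ne {E : Type*} [NormedAddCommGroup E]
    [NormedSpace ℝ E] [FiniteDimensional ℝ E] {W : Set E} (hW : Convex ℝ W) (hne : W.Nonempty)
    (h : ∀ l : E →L[ℝ] ℝ, l ≠ 0 → ∀ c, ∃ y ∈ W, l y ≠ c) : (interior W).Nonempty := by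
  rw [hW.interior_nonempty_iff_affineSpan_eq_top]
  by_contra hsp
  have hdir : (affineSpan ℝ W).direction < ⊤ := lt_top_iff_ne_top.2 fun h =>
    hsp ((AffineSubspace.direction_eq_top_iff_of_nonempty
      ((affineSpan_nonempty ℝ).2 hne)).1 h)
  obtain ⟨f, hf0, hf⟩ := Submodule.exists_le_ker_of_lt_top _ hdir
  obtain ⟨y₀, hy₀⟩ := hne
  obtain ⟨y, hy, hyn⟩ := h f.toContinuousLinearMap (fun h0 => hf0 (by
    ext x
    exact congrArg (fun g : E →L[ℝ] ℝ => g x) h0)) (f y₀)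
  have := hf (AffineSubspace.vsub_mem_direction (subset_affineSpan ℝ W hy)
    (subset_affineSpan ℝ W hy₀))
  rw [LinearMap.mem_ker, vsub_eq_sub, map_sub, sub_eq_zero] at this
  exact hyn this

theorem IsPreconnected.inter_preimage_of_injOn {X Y : Type*} [TopologicalSpace X]
    [TopologicalSpace Y] [T2Space Y] {K : Set X} (hK : IsCompact K) {F : X → Y}
    (hF : ContinuousOn F K) (hinj : InjOn F K) {T : Set Y} (hT : IsPreconnected T)
    (hTK : T ⊆ F '' K) : IsPreconnected (K ∩ F ⁻¹' T) := by
  have : CompactSpace K := isCompact_iff_compactSpace.1 hK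
  have h := hT.preimage_of_isClosedMap (f := K.domRestrict F) (injOn_iff_injective.1 hinj)
    (continuousOn_iff_continuous_domRestrict.1 hF).isClosedMap (by rwa [range_domRestrict])
  have h2 := h.image Subtype.val continuous_subtype_val.continuousOn
  convert h2 using 1
  ext x
  simp [and_comm]

theorem IsPolygonalCCWParam.sum_smul_eq {γ δ : ℝ → ℝ × ℝ} {n : ℕ} {v w : ℕ → ℝ × ℝ}
    {V W : Set (ℝ × ℝ)} {φ : ℕ → ℝ × ℝ → ℝ} (hn : 0 < n) (hv : ∀ i, v (i + n) = v i)
    (hw : ∀ i, w (i + n) = w i) (hγ : IsPolygonalCCWParam γ n v V)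
    (hδ : IsPolygonalCCWParam δ n w W) (hφ : IsHarmonicGBC n v V φ) {t : ℝ} (ht : t ∈ Ico 0 1) :
    ∑ j ∈ Finset.range n, φ j (γ t) • w j = δ t := by
  obtain ⟨-, -, -, -, -, haff, hkron⟩ := hφ
  have hvert : ∀ i, ∑ j ∈ Finset.range n, φ j (v i) • w j = w i := fun i => by
    have hi := Nat.mod_lt i hn
    rw [← Function.Periodic.map_mod_nat (f := v) hv i,
      ← Function.Periodic.map_mod_nat (f := w) hw i,
      Finset.sum_eq_single_of_mem (i % n) (Finset.mem_range.2 hi)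
      (fun j hj hji => by rw [hkron j _ (Finset.mem_range.1 hj) hi, if_neg hji, zero_smul]),
      hkron _ _ hi hi, if_pos rfl, one_smul]
  have hn' : (0 : ℝ) < n := by exact_mod_cast hn
  have htn : 0 ≤ t * n := mul_nonneg ht.1 hn'.le
  have hs : t * n - ⌊t * n⌋₊ ∈ Icc (0 : ℝ) 1 :=
    ⟨by linarith [Nat.floor_le htn], by linarith [Nat.lt_floor_add_one (t * n)]⟩
  have hts : t = ((⌊t * n⌋₊ : ℕ) + (t * n - ⌊t * n⌋₊)) / n := by
    field_simp
    ring
  generalize t * n - ⌊t * n⌋₊ = s at hs hts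
  rw [hts, hγ.2 _ _ hs, hδ.2 _ _ hs]
  simp only [haff _ _ s hs, add_smul, mul_smul, Finset.sum_add_distrib, ← Finset.smul_sum, hvert]

theorem WindsCCWAround.exists_log {γ : ℝ → ℝ × ℝ} {z : ℝ × ℝ} (h : WindsCCWAround γ z) :
    ∃ L : ℝ → ℂ, Continuous L ∧ ∀ t, Complex.exp (L t) =
      Complex.equivRealProdCLM.symm (γ t) - Complex.equivRealProdCLM.symm z := by
  obtain ⟨r, θ, hr, hθ, hr0, hpol, -⟩ := h
  refine ⟨fun t => (Real.log (r t) : ℝ) + θ t * Complex.I, ?_, fun t => ?_⟩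
  · have := hr.log (fun t => (hr0 t).ne')
    fun_prop
  · rw [← map_sub, eq_comm, ContinuousLinearEquiv.symm_apply_eq, hpol, Complex.exp_add,
      ← Complex.ofReal_exp, Real.exp_log (hr0 t), Complex.exp_mul_I, ← Complex.ofReal_cos,
      ← Complex.ofReal_sin]
    ext <;> simp [-Complex.ofReal_cos, -Complex.ofReal_sin]

theorem HarmonicOn2.harmonicAt {u : ℝ × ℝ → ℝ} {Ω : Set (ℝ × ℝ)} (hu : HarmonicOn2 u Ω)
    (hΩ : IsOpen Ω) {z : ℂ} (hz : Complex.equivRealProdCLM z ∈ Ω) :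
    InnerProductSpace.HarmonicAt (fun z => u (Complex.equivRealProdCLM z)) z := by
  set e := Complex.equivRealProdCLM with he
  have hC : ∀ z, e z ∈ Ω → ContDiffAt ℝ 2 (fun z => u (e z)) z := fun z hz =>
    (hu.1.contDiffAt (hΩ.mem_nhds hz)).comp z e.contDiff.contDiffAt
  refine ⟨hC z hz, ?_⟩
  filter_upwards [e.continuous.continuousAt.preimage_mem_nhds (hΩ.mem_nhds hz)] with y hy
  have hd : DifferentiableAt ℝ (fderiv ℝ (fun z => u (e z))) y :=
    ((hC y hy).fderiv_right (m := 1) (by norm_num)).differentiableAt (by norm_num)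
  have h1 : ∀ (g : ℝ × ℝ → ℝ) (x c : ℂ), fderiv ℝ (fun z => g (e z)) x c = fderiv ℝ g (e x) (e c) :=
    fun g x c => by
      have := e.comp_right_fderiv (f := g) (x := x)
      exact congrArg (fun A : ℂ →L[ℝ] ℝ => A c) this
  have h2 : ∀ c : ℂ, fderiv ℝ (fderiv ℝ (fun z => u (e z))) y c c =
      fderiv ℝ (fun q => fderiv ℝ u q (e c)) (e y) (e c) := fun c => by
    rw [← h1 (fun q => fderiv ℝ u q (e c))]
    simp only [← h1]
    rw [fderiv_clm_apply hd (differentiableAt_const c)]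
    simp
  rw [InnerProductSpace.laplacian_eq_iteratedFDeriv_complexPlane]
  simp only [iteratedFDeriv_two_apply, Matrix.cons_val_zero, Matrix.cons_val_one, h2]
  simpa [lap2, he] using hu.2 _ hy

theorem InnerProductSpace.HarmonicAt.sum {ι : Type*} {s : Finset ι} {f : ι → ℂ → ℝ} {z : ℂ}
    (h : ∀ i ∈ s, HarmonicAt (f i) z) : HarmonicAt (fun z => ∑ i ∈ s, f i z) z := by
  classical
  induction s using Finset.induction_on with
  | empty => simp
  | insert i s hi ih =>
    simp only [Finset.sum_insert hi]
    exact (h i (Finset.mem_insert_self i s)).add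
      (ih fun j hj => h j (Finset.mem_insert_of_mem hj))

/-- A harmonic map between a simple polygon and a convex one, read in the complex plane. -/
theorem IsHarmonicGBC.isHarmonicLevelMap {n : ℕ} {v w : ℕ → ℝ × ℝ} {V W : Set (ℝ × ℝ)}
    {φ : ℕ → ℝ × ℝ → ℝ} (hV : IsSimplePolygonCCW V n v) (hφ : IsHarmonicGBC n v V φ)
    (hW : IsConvexPolygonCCW W n w) {F : ℝ × ℝ → ℝ × ℝ}
    (hF : F = fun x => ∑ i ∈ Finset.range n, φ i x • w i)
    (hFW : MapsTo F V W) (hFf : F '' frontier V = frontier W) (hFi : InjOn F (frontier V)) :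
    IsHarmonicLevelMap (Complex.equivRealProdCLM ⁻¹' V)
      (fun z => F (Complex.equivRealProdCLM z)) := by
  obtain ⟨hn, -, hVc, -, -, γ, ⟨hγ, hγper, hγinj, hγfr, hγw⟩, -⟩ := hV
  obtain ⟨hw, hWh, δ, ⟨hδ, hδper, hδinj, hδfr, -⟩, -⟩ := hW
  obtain ⟨hφc, hφh, -⟩ := hφ
  have hWc : Convex ℝ W := hWh ▸ convex_convexHull ℝ _
  set e := Complex.equivRealProdCLM with he
  have hFc : ContinuousOn F V := by
    rw [hF]
    exact continuousOn_finsetSum _ fun i _ => (hφc i).smul continuousOn_const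
  have hWcomp : IsCompact W := by
    have hfin : (range w).Finite := ((Finset.range n).finite_toSet.image w).subset (by
      rintro _ ⟨i, rfl⟩
      exact ⟨i % n, Finset.mem_coe.2 (Finset.mem_range.2 (Nat.mod_lt i (by omega))),
        Function.Periodic.map_mod_nat (f := w) hw i⟩)
    exact hWh ▸ hfin.isCompact_convexHull ℝ
  have hγr : range γ = frontier V := by
    rw [← hγfr]
    refine (image_subset_range _ _).antisymm' ?_
    rintro _ ⟨t, rfl⟩
    obtain ⟨s, hs, hst⟩ := Function.Periodic.exists_mem_Ico₀ (f := γ) hγper one_pos t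
    exact hst ▸ mem_image_of_mem γ hs
  have hδr : ∀ t, δ t ∈ frontier W := fun t => by
    obtain ⟨s, hs, hst⟩ := Function.Periodic.exists_mem_Ico₀ (f := δ) hδper one_pos t
    rw [hst, ← hδfr]
    exact mem_image_of_mem δ hs
  have hfr : frontier (e ⁻¹' V) = e ⁻¹' frontier V :=
    (e.toHomeomorph.preimage_frontier V).symm
  have hint : interior (e ⁻¹' V) = e ⁻¹' interior V :=
    (e.toHomeomorph.preimage_interior V).symm
  have hfrc : IsCompact (frontier V) := hVc.of_isClosed_subset isClosed_frontier
    hVc.isClosed.frontier_subset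
  have hex : ∀ l : ℝ × ℝ →L[ℝ] ℝ, l ≠ 0 → ∀ c, ∃ y ∈ frontier W, l y ≠ c := fun l hl c => by
    obtain ⟨t, ht⟩ := exists_ne_of_periodic hδ hδper hδinj hl c
    exact ⟨δ t, hδr t, ht⟩
  have hWne : (interior W).Nonempty := hWc.interior_nonempty_of_forall_exists_ne
    ⟨δ 0, hWcomp.isClosed.frontier_subset (hδr 0)⟩ fun l hl c => by
      obtain ⟨y, hy, hyc⟩ := hex l hl c
      exact ⟨y, hWcomp.isClosed.frontier_subset hy, hyc⟩
  refine ⟨e.toHomeomorph.isCompact_preimage.2 hVc,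
    hFc.comp e.continuous.continuousOn (mapsTo_preimage e V), ?_, ?_, ?_, ?_⟩
  · intro p hp l
    rw [hint] at hp
    have : (fun z => l (F (e z))) = fun z => ∑ i ∈ Finset.range n, l (w i) • φ i (e z) := by
      ext z
      simp [hF, mul_comm]
    rw [this]
    exact InnerProductSpace.HarmonicAt.sum fun i _ =>
      ((hφh i).harmonicAt isOpen_interior hp).const_smul
  · intro D _ hDb p hpD hp hsub
    rw [hint] at hp
    obtain ⟨L, hL, hexp⟩ := (hγw _ hp).exists_log
    have hr : range (fun t => e.symm (γ t)) = frontier (e ⁻¹' V) := by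
      rw [hfr, ← hγr]
      ext z
      simp [ContinuousLinearEquiv.symm_apply_eq]
    rw [← hr] at hsub ⊢
    exact subset_frontier_of_periodic (by fun_prop) (fun t => by simp only [hγper])
      (fun s hs t ht hst => hγinj hs ht (e.symm.injective hst)) hL
      (fun t => by rw [hexp t, e.symm_apply_apply]) hDb hpD hsub
  · rintro l c ⟨x, hx, hxc⟩ ⟨y, hy, hyc⟩
    have h1 := hWc.isPreconnected_frontier_halfSpace hWcomp.isBounded hWne
      ⟨_, hFW hx, hxc⟩ ⟨_, hFW hy, hyc⟩
    have h2 := IsPreconnected.inter_preimage_of_injOn hfrc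
      (hFc.mono hVc.isClosed.frontier_subset) hFi h1 (fun y hy => hFf ▸ hy.1)
    rw [← e.toHomeomorph.isPreconnected_preimage] at h2
    convert h2 using 1
    rw [hfr]
    ext z
    constructor
    · rintro ⟨hz, hzc⟩
      exact ⟨hz, hFf ▸ mem_image_of_mem F hz, hzc⟩
    · rintro ⟨hz, -, hzc⟩
      exact ⟨hz, hzc⟩
  · intro l hl c
    obtain ⟨y, hy, hyc⟩ := hex l hl c
    rw [← hFf] at hy
    obtain ⟨x, hx, rfl⟩ := hy
    exact ⟨e.symm x, by rw [hfr]; simpa using hx, by simpa using hyc⟩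

/-- The harmonic GBC map from a simple polygon `V` (vertices
counterclockwise) to a convex polygon `W` (vertices counterclockwise) is injective on `V`. -/
theorem harmonic_gbc_map_injective (n : ℕ) (v w : ℕ → ℝ × ℝ) (V W : Set (ℝ × ℝ))
    (φ : ℕ → (ℝ × ℝ) → ℝ) (hV : IsSimplePolygonCCW V n v) (hφ : IsHarmonicGBC n v V φ)
    (hW : IsConvexPolygonCCW W n w) :
    Set.InjOn (fun x => ∑ i ∈ Finset.range n, φ i x • w i) V := by
  obtain ⟨hn, hv, hVc, -, -, γ, hγ⟩ := id hV
  obtain ⟨hw, hWh, δ, hδ⟩ := id hW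
  have hbd := fun t (ht : t ∈ Ico (0 : ℝ) 1) => hγ.sum_smul_eq (by omega) hv hw hδ hφ ht
  obtain ⟨⟨-, -, -, hγfr, -⟩, -⟩ := hγ
  obtain ⟨⟨-, -, hδinj, hδfr, -⟩, -⟩ := hδ
  have hFW : MapsTo (fun x => ∑ i ∈ Finset.range n, φ i x • w i) V W := fun x hx => by
    rw [hWh]
    exact (convex_convexHull ℝ _).sum_mem (fun i _ => hφ.2.2.2.2.1 i x hx) (hφ.2.2.1 x hx)
      fun i _ => subset_convexHull ℝ _ (mem_range_self i)
  have hFf : (fun x => ∑ i ∈ Finset.range n, φ i x • w i) '' frontier V = frontier W := by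
    rw [← hγfr, ← hδfr, image_image]
    exact image_congr hbd
  have hFi : InjOn (fun x => ∑ i ∈ Finset.range n, φ i x • w i) (frontier V) := by
    rw [← hγfr]
    rintro _ ⟨s, hs, rfl⟩ _ ⟨t, ht, rfl⟩ hst
    exact congrArg γ (hδinj hs ht ((hbd s hs).symm.trans (hst.trans (hbd t ht))))
  have H := hφ.isHarmonicLevelMap hV hW rfl hFW hFf hFi
  have hfr : ∀ z ∈ frontier (Complex.equivRealProdCLM ⁻¹' V),
      Complex.equivRealProdCLM z ∈ frontier V := fun z hz =>
    (Complex.equivRealProdCLM.toHomeomorph.preimage_frontier V).symm.subset hz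
  have hinj := H.injOn (W := W) (fun z hz => hFW hz)
    (fun z hz => hFf ▸ mem_image_of_mem _ (hfr z hz))
    (fun y hy z hz hyz => Complex.equivRealProdCLM.injective (hFi (hfr y hy) (hfr z hz) hyz))
  intro x hx y hy hxy
  refine Complex.equivRealProdCLM.symm.injective (hinj ?_ ?_ ?_)
  · simpa only [mem_preimage, ContinuousLinearEquiv.apply_symm_apply] using hx
  · simpa only [mem_preimage, ContinuousLinearEquiv.apply_symm_apply] using hy
  · simpa only [ContinuousLinearEquiv.apply_symm_apply] using hxy
end
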